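/- arXiv:2306.02365 — 6 statements merged into one kernel-verified Lean document; each statement's English description precedes it below -/
import Mathlib

section
/- Let B be a unital C*-algebra and let b_1, …, b_n ∈ B satisfy ∑_{k=1}^n b_k b_k* ≤ 1. Let W(b_1,…,b_n) = {(ψ(b_1),…,ψ(b_n)) : ψ a state on B} ⊆ ℂⁿ, and assume that every extreme point (z_1,…,z_n) of the convex set W(b_1,…,b_n) satisfies ∑_{k=1}^n |z_k|² = 1. Let M = span_ℂ{1, b_1, …, b_n}, let A ⊆ B be the unital subalgebra generated by M, and let D ⊆ B be the norm closure of the linear span of {a b* : a, b ∈ A} (note M ⊆ D). If ω is a pure state on M, then there is a unique state ψ on D whose restriction to M equals ω; moreover this ψ satisfies ψ(b_k d) = ω(b_k) ψ(d) and ψ(b_k d b_j*) = ω(b_k) ψ(d) · conj(ω(b_j)) for all 1 ≤ j, k ≤ n and all d ∈ D. -/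
noncomputable section

open scoped ComplexOrder

variable {B : Type*} [NormedRing B] [StarRing B] [CStarRing B] [NormedAlgebra ℂ B]
  [StarModule ℂ B] [CompleteSpace B]

/-- A state on `B`: a unital contractive linear functional. -/
def IsState (φ : B →ₗ[ℂ] ℂ) : Prop :=
  φ 1 = 1 ∧ ∀ b : B, ‖φ b‖ ≤ ‖b‖

/-- A state on a (unital) subspace `N` of `B`. -/
def IsStateOn (N : Submodule ℂ B) (φ : N →ₗ[ℂ] ℂ) : Prop :=
  (∀ h1 : (1 : B) ∈ N, φ ⟨1, h1⟩ = 1) ∧ ∀ m : N, ‖φ m‖ ≤ ‖(m : B)‖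

/-- A pure state on a subspace: an extreme point of the set of states on it. -/
def IsPureStateOn (N : Submodule ℂ B) (φ : N →ₗ[ℂ] ℂ) : Prop :=
  φ ∈ Set.extremePoints ℝ {ψ : N →ₗ[ℂ] ℂ | IsStateOn N ψ}

section PositiveFunctionals

set_option linter.unusedSectionVars false

variable {C : Type*} [CStarAlgebra C] [PartialOrder C] [StarOrderedRing C]

/-- A unital contractive functional is real on self-adjoint elements. -/
lemma im_apply_eq_zero_of_contractive (φ : C →ₗ[ℂ] ℂ) (h1 : φ 1 = 1) (hφ : ∀ x, ‖φ x‖ ≤ ‖x‖)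
    {a : C} (ha : IsSelfAdjoint a) : (φ a).im = 0 := by
  have key : ∀ t : ℝ, ((φ a).im + t) ^ 2 ≤ ‖a‖ ^ 2 + t ^ 2 * ‖(1 : C)‖ := by
    intro t
    set y : C := a + (t * Complex.I : ℂ) • (1 : C) with hy
    have hyy : star y * y = a * a + ((t : ℂ) ^ 2) • (1 : C) := by
      have hI : (-(t * (Complex.I * (t * Complex.I))) : ℂ) = (t : ℂ) ^ 2 := by
        linear_combination (-(t : ℂ) ^ 2) * Complex.I_sq
      rw [hy, star_add, ha.star_eq, star_smul, star_one, add_mul, mul_add, mul_add]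
      simp only [smul_mul_assoc, mul_smul_comm, one_mul, mul_one, smul_smul, star_mul',
        Complex.star_def, Complex.conj_ofReal, Complex.conj_I]
      rw [← hI]
      module
    have hy2 : ‖y‖ ^ 2 ≤ ‖a‖ ^ 2 + t ^ 2 * ‖(1 : C)‖ := by
      rw [sq, ← CStarRing.norm_star_mul_self, hyy]
      refine (norm_add_le _ _).trans (add_le_add ?_ ?_)
      · rw [sq]; exact norm_mul_le a a
      · rw [norm_smul]; simp
    have hφy : (φ y).im = (φ a).im + t := by simp [hy, h1]
    calc ((φ a).im + t) ^ 2 = (φ y).im ^ 2 := by rw [hφy]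
      _ ≤ ‖φ y‖ ^ 2 := by
        rw [← sq_abs (φ y).im]
        exact pow_le_pow_left₀ (abs_nonneg _) (Complex.abs_im_le_norm _) 2
      _ ≤ ‖y‖ ^ 2 := pow_le_pow_left₀ (norm_nonneg _) (hφ y) 2
      _ ≤ _ := hy2
  have hnt : Nontrivial C := by
    refine ⟨1, 0, fun h => ?_⟩
    rw [h, map_zero] at h1
    exact zero_ne_one h1
  rw [CStarRing.norm_one] at key
  by_contra h
  have h2 := key (‖a‖ ^ 2 / (2 * (φ a).im))
  have h3 : 2 * (φ a).im * (‖a‖ ^ 2 / (2 * (φ a).im)) = ‖a‖ ^ 2 := by field_simp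
  have h4 : 0 < (φ a).im ^ 2 := by positivity
  nlinarith

/-- A unital contractive functional is nonnegative on positive elements. -/
lemma apply_nonneg_of_contractive (φ : C →ₗ[ℂ] ℂ) (h1 : φ 1 = 1) (hφ : ∀ x, ‖φ x‖ ≤ ‖x‖)
    {a : C} (ha : 0 ≤ a) : 0 ≤ φ a := by
  have hsa : IsSelfAdjoint a := .of_nonneg ha
  have hle : a ≤ algebraMap ℝ C ‖a‖ := hsa.le_algebraMap_norm_self
  have hn : ‖algebraMap ℝ C ‖a‖ - a‖ ≤ ‖a‖ := by
    rw [CStarAlgebra.norm_le_iff_le_algebraMap _ (norm_nonneg a) (sub_nonneg.2 hle)]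
    exact sub_le_self _ ha
  have hval : φ (algebraMap ℝ C ‖a‖ - a) = ‖a‖ - φ a := by
    rw [map_sub, Algebra.algebraMap_eq_smul_one, ← Complex.coe_smul, map_smul, h1]
    simp
  have h3 : ‖a‖ - (φ a).re ≤ ‖a‖ := by
    have := (Complex.re_le_norm _).trans ((hφ (algebraMap ℝ C ‖a‖ - a)).trans hn)
    rw [hval] at this
    simpa using this
  rw [Complex.nonneg_iff]
  exact ⟨by linarith, (im_apply_eq_zero_of_contractive φ h1 hφ hsa).symm⟩

/-- Cauchy-Schwarz: the left kernel of a positive functional. -/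
lemma PositiveLinearMap.apply_mul_eq_zero (f : C →ₚ[ℂ] ℂ) {x : C} (hx : f (x * star x) = 0)
    (y : C) : f (x * y) = 0 := by
  have h0 : ‖f.toPreGNS (star x)‖ = 0 := by
    rw [PositiveLinearMap.preGNS_norm_def]
    simp [hx]
  have h1 := norm_inner_le_norm (𝕜 := ℂ) (f.toPreGNS (star x)) (f.toPreGNS y)
  rw [h0, zero_mul, PositiveLinearMap.preGNS_inner_def] at h1
  simpa using h1

/-- If a positive unital functional attains the norm of a row contraction, it is multiplicative
with respect to the entries of the row. -/
lemma PositiveLinearMap.apply_mul_of_row_contraction (f : C →ₚ[ℂ] ℂ) (h1 : f 1 = 1)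
    {ι : Type*} [Fintype ι] (b : ι → C) (hb : ∑ k, b k * star (b k) ≤ 1)
    (hz : ∑ k, ‖f (b k)‖ ^ 2 = 1) (k : ι) (x : C) : f (b k * x) = f (b k) * f x := by
  let c : ι → C := fun k => b k - f (b k) • (1 : C)
  have hc : ∀ k, f (c k * star (c k)) = f (b k * star (b k)) - (‖f (b k)‖ ^ 2 : ℝ) := by
    intro k
    have hs : f (star (b k)) = star (f (b k)) := map_star f (b k)
    simp only [c, star_sub, star_smul, star_one, sub_mul, mul_sub, smul_mul_assoc,
      mul_smul_comm, one_mul, mul_one, map_sub, map_smul, h1, hs, smul_eq_mul, smul_sub]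
    have : f (b k) * star (f (b k)) = ((‖f (b k)‖ ^ 2 : ℝ) : ℂ) := by
      rw [Complex.star_def, Complex.mul_conj, Complex.normSq_eq_norm_sq]
    linear_combination (-1 : ℂ) * this
  have hpos : ∀ k, 0 ≤ f (c k * star (c k)) := fun k => f.map_nonneg (mul_star_self_nonneg _)
  have hsum : ∑ k, f (c k * star (c k)) ≤ 0 := by
    have h2 : f (∑ k, b k * star (b k)) ≤ f 1 := OrderHomClass.mono f hb
    rw [map_sum, h1] at h2
    simp_rw [hc]
    rw [Finset.sum_sub_distrib, ← Complex.ofReal_sum, hz]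
    simpa using h2
  have hzero : f (c k * star (c k)) = 0 :=
    (Finset.sum_eq_zero_iff_of_nonneg fun k _ => hpos k).1
      (le_antisymm hsum (Finset.sum_nonneg fun k _ => hpos k)) k (Finset.mem_univ k)
  have := f.apply_mul_eq_zero hzero x
  simp only [c, sub_mul, smul_mul_assoc, one_mul, map_sub, map_smul, smul_eq_mul] at this
  exact sub_eq_zero.1 this

end PositiveFunctionals

section States

set_option linter.unusedSectionVars false

/-- A state is a positive linear functional. -/
lemma IsState.exists_positiveLinearMap [PartialOrder B] [StarOrderedRing B]
    {φ : B →ₗ[ℂ] ℂ} (hφ : IsState φ) : ∃ f : B →ₚ[ℂ] ℂ, ∀ x, f x = φ x := by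
  let : CStarAlgebra B := {}
  exact ⟨PositiveLinearMap.mk₀ φ fun x hx => apply_nonneg_of_contractive φ hφ.1 hφ.2 hx,
    fun x => rfl⟩

lemma IsState.apply_star [PartialOrder B] [StarOrderedRing B]
    {φ : B →ₗ[ℂ] ℂ} (hφ : IsState φ) (x : B) : φ (star x) = star (φ x) := by
  let : CStarAlgebra B := {}
  obtain ⟨f, hf⟩ := hφ.exists_positiveLinearMap
  rw [← hf, ← hf]
  exact map_star f x

lemma IsState.apply_mul_of_row_contraction [PartialOrder B] [StarOrderedRing B]
    {φ : B →ₗ[ℂ] ℂ} (hφ : IsState φ) {ι : Type*} [Fintype ι] (b : ι → B)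
    (hb : ∑ k, b k * star (b k) ≤ 1) (hz : ∑ k, ‖φ (b k)‖ ^ 2 = 1) (k : ι) (x : B) :
    φ (b k * x) = φ (b k) * φ x := by
  let : CStarAlgebra B := {}
  obtain ⟨f, hf⟩ := hφ.exists_positiveLinearMap
  simp only [← hf] at hz ⊢
  exact f.apply_mul_of_row_contraction (by rw [hf, hφ.1]) b hb hz k x

/-- States on a unital subspace extend to states on the whole algebra. -/
lemma IsStateOn.exists_extension {N : Submodule ℂ B} (h1 : (1 : B) ∈ N) {φ : N →ₗ[ℂ] ℂ}
    (hφ : IsStateOn N φ) : ∃ ψ : B →ₗ[ℂ] ℂ, IsState ψ ∧ ∀ x : N, ψ x = φ x := by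
  obtain ⟨g, hg, hgn⟩ := exists_extension_norm_eq N
    (φ.mkContinuous 1 fun x => by simpa using hφ.2 x)
  refine ⟨g.toLinearMap, ⟨?_, fun x => ?_⟩, fun x => by simpa using hg x⟩
  · have := hg ⟨1, h1⟩
    simpa [hφ.1 h1] using this
  · have hg1 : ‖g‖ ≤ 1 := by
      rw [hgn]; exact LinearMap.mkContinuous_norm_le _ zero_le_one _
    simpa using g.le_of_opNorm_le hg1 x

lemma IsState.isStateOn_restrict {φ : B →ₗ[ℂ] ℂ} (hφ : IsState φ) (N : Submodule ℂ B) :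
    IsStateOn N (φ ∘ₗ N.subtype) :=
  ⟨fun _ => hφ.1, fun m => hφ.2 m⟩

/-- Two states that are left multiplicative with respect to `s` and agree on `s` agree on all
products `a * star c` with `a` and `c` in the algebra generated by `s`. -/
lemma IsState.apply_mul_star_eq [PartialOrder B] [StarOrderedRing B] {φ ψ : B →ₗ[ℂ] ℂ}
    (hφ : IsState φ) (hψ : IsState ψ) {s : Set B} (heq : ∀ a ∈ s, φ a = ψ a)
    (hφs : ∀ a ∈ s, ∀ x, φ (a * x) = φ a * φ x) (hψs : ∀ a ∈ s, ∀ x, ψ (a * x) = ψ a * ψ x)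
    {a c : B} (ha : a ∈ Algebra.adjoin ℂ s) (hc : c ∈ Algebra.adjoin ℂ s) :
    φ (a * star c) = ψ (a * star c) := by
  have key : ∀ a ∈ Algebra.adjoin ℂ s,
      (∀ x, φ (a * x) = φ a * φ x) ∧ (∀ x, ψ (a * x) = ψ a * ψ x) ∧ φ a = ψ a := by
    intro a ha
    induction ha using Algebra.adjoin_induction with
    | mem a ha => exact ⟨hφs a ha, hψs a ha, heq a ha⟩
    | algebraMap r => simp [Algebra.algebraMap_eq_smul_one, hφ.1, hψ.1]
    | add a c _ _ iha ihc =>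
      refine ⟨fun x => ?_, fun x => ?_, ?_⟩
      · rw [add_mul, map_add, map_add, iha.1, ihc.1, add_mul]
      · rw [add_mul, map_add, map_add, iha.2.1, ihc.2.1, add_mul]
      · rw [map_add, map_add, iha.2.2, ihc.2.2]
    | mul a c _ _ iha ihc =>
      refine ⟨fun x => ?_, fun x => ?_, ?_⟩
      · rw [mul_assoc, iha.1, ihc.1, iha.1, mul_assoc]
      · rw [mul_assoc, iha.2.1, ihc.2.1, iha.2.1, mul_assoc]
      · rw [iha.1, ihc.2.2, iha.2.2, iha.2.1]
  rw [(key a ha).1, (key a ha).2.1, hφ.apply_star, hψ.apply_star, (key a ha).2.2,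
    (key c hc).2.2]

/-- Agreement of states on a set passes to the closed linear span. -/
lemma IsState.eqOn_closure_span {φ ψ : B →ₗ[ℂ] ℂ} (hφ : IsState φ) (hψ : IsState ψ) {s : Set B}
    (heq : ∀ x ∈ s, φ x = ψ x) : ∀ x ∈ (Submodule.span ℂ s).topologicalClosure, φ x = ψ x := by
  have hφc : Continuous φ :=
    (φ.mkContinuous 1 fun x => by simpa using hφ.2 x).continuous
  have hψc : Continuous ψ :=
    (ψ.mkContinuous 1 fun x => by simpa using hψ.2 x).continuous
  intro x hx
  have hxcl : x ∈ closure (Submodule.span ℂ s : Set B) := hx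
  exact closure_minimal (fun y hy => LinearMap.eqOn_span heq hy)
    (isClosed_eq hφc hψc) hxcl

/-- A pure state on the span of `1` and `b` gives an extreme point of the joint numerical range. -/
lemma IsPureStateOn.mem_extremePoints {ι : Type*} {b : ι → B} {M : Submodule ℂ B}
    (hM : M = Submodule.span ℂ ({1} ∪ Set.range b)) {ω : M →ₗ[ℂ] ℂ} (hω : IsPureStateOn M ω)
    {φ : B →ₗ[ℂ] ℂ} (hφ : IsState φ) (hφω : ∀ x : M, φ x = ω x) :
    (fun k => φ (b k)) ∈ Set.extremePoints ℝ
      {z : ι → ℂ | ∃ ψ : B →ₗ[ℂ] ℂ, IsState ψ ∧ ∀ k, ψ (b k) = z k} := by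
  refine ⟨⟨φ, hφ, fun k => rfl⟩, ?_⟩
  rintro x ⟨ψ₁, h₁, hx⟩ y ⟨ψ₂, h₂, hy⟩ ⟨s, t, hs, ht, hst, hz⟩
  have hmem : ∀ k, b k ∈ M := fun k => hM ▸ Submodule.subset_span (Or.inr ⟨k, rfl⟩)
  have hseg : s • (ψ₁ ∘ₗ M.subtype) + t • (ψ₂ ∘ₗ M.subtype) = ω := by
    have heq : Set.EqOn (((s : ℂ) • ψ₁ + (t : ℂ) • ψ₂ : B →ₗ[ℂ] ℂ)) φ
        (Submodule.span ℂ ({1} ∪ Set.range b)) := by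
      refine LinearMap.eqOn_span ?_
      rintro _ (rfl | ⟨k, rfl⟩)
      · simp only [LinearMap.add_apply, LinearMap.smul_apply, h₁.1, h₂.1, hφ.1, smul_eq_mul,
          mul_one]
        exact_mod_cast hst
      · have := congrFun hz k
        simpa [hx, hy] using this
    ext m
    rw [← hφω, ← heq (by rw [← hM]; exact m.2)]
    simp
  have h := hω.2 (h₁.isStateOn_restrict M) (h₂.isStateOn_restrict M) ⟨s, t, hs, ht, hst, hseg⟩
  funext k
  rw [← hx, hφω ⟨b k, hmem k⟩, ← h]
  rfl

end States

theorem stmt0 [PartialOrder B] [StarOrderedRing B]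
    (n : ℕ) (b : Fin n → B)
    (hb : ∑ k, b k * star (b k) ≤ 1)
    (hext : ∀ z ∈ Set.extremePoints ℝ
        {z : Fin n → ℂ | ∃ ψ : B →ₗ[ℂ] ℂ, IsState ψ ∧ ∀ k, ψ (b k) = z k},
      ∑ k, ‖z k‖ ^ 2 = 1)
    (M : Submodule ℂ B) (hM : M = Submodule.span ℂ ({1} ∪ Set.range b))
    (A : Subalgebra ℂ B) (hA : A = Algebra.adjoin ℂ (Set.range b))
    (D : Submodule ℂ B)
    (hD : D = (Submodule.span ℂ
      {x : B | ∃ a ∈ A, ∃ c ∈ A, x = a * star c}).topologicalClosure)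
    (ω : M →ₗ[ℂ] ℂ) (hω : IsPureStateOn M ω) :
    ∃ ψ : D →ₗ[ℂ] ℂ,
      (IsStateOn D ψ ∧
        ∀ (m : B) (hm : m ∈ M) (hmD : m ∈ D), ψ ⟨m, hmD⟩ = ω ⟨m, hm⟩) ∧
      (∀ ψ' : D →ₗ[ℂ] ℂ,
        (IsStateOn D ψ' ∧
          ∀ (m : B) (hm : m ∈ M) (hmD : m ∈ D), ψ' ⟨m, hmD⟩ = ω ⟨m, hm⟩) →
        ψ' = ψ) ∧
      (∀ (k : Fin n) (d : B) (hd : d ∈ D) (hk : b k ∈ M) (hkd : b k * d ∈ D),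
        ψ ⟨b k * d, hkd⟩ = ω ⟨b k, hk⟩ * ψ ⟨d, hd⟩) ∧
      (∀ (j k : Fin n) (d : B) (hd : d ∈ D) (hk : b k ∈ M) (hj : b j ∈ M)
        (hkdj : b k * d * star (b j) ∈ D),
        ψ ⟨b k * d * star (b j), hkdj⟩ =
          ω ⟨b k, hk⟩ * ψ ⟨d, hd⟩ * star (ω ⟨b j, hj⟩)) := by
  have h1M : (1 : B) ∈ M := hM ▸ Submodule.subset_span (Or.inl rfl)
  have hbM : ∀ k, b k ∈ M := fun k => hM ▸ Submodule.subset_span (Or.inr ⟨k, rfl⟩)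
  have hAD : ∀ a ∈ A, a ∈ D := fun a ha => by
    rw [hD]
    exact Submodule.le_topologicalClosure _
      (Submodule.subset_span ⟨a, ha, 1, A.one_mem, by simp⟩)
  have h1D : (1 : B) ∈ D := hAD 1 A.one_mem
  have hbD : ∀ k, b k ∈ D := fun k =>
    hAD _ (hA ▸ Algebra.subset_adjoin (Set.mem_range_self k))
  obtain ⟨φ, hφ, hφω⟩ := hω.1.exists_extension h1M
  have hz : ∑ k, ‖φ (b k)‖ ^ 2 = 1 := hext _ (hω.mem_extremePoints hM hφ hφω)
  have hmul := hφ.apply_mul_of_row_contraction b hb hz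
  refine ⟨φ ∘ₗ D.subtype, ⟨hφ.isStateOn_restrict D, fun m hm _ => hφω ⟨m, hm⟩⟩, ?_, ?_, ?_⟩
  · rintro ψ' ⟨hψ', hψ'ω⟩
    obtain ⟨ψ, hψ, hψe⟩ := hψ'.exists_extension h1D
    have hagree : ∀ k, ψ (b k) = φ (b k) := fun k => by
      rw [hψe ⟨b k, hbD k⟩, hψ'ω _ (hbM k), ← hφω]
    have hzψ : ∑ k, ‖ψ (b k)‖ ^ 2 = 1 := by simpa only [hagree] using hz
    have hmulψ := hψ.apply_mul_of_row_contraction b hb hzψ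
    ext d
    rw [← hψe]
    refine hψ.eqOn_closure_span hφ ?_ d (by rw [← hD]; exact d.2)
    rintro _ ⟨a, ha, c, hc, rfl⟩
    rw [hA] at ha hc
    exact hψ.apply_mul_star_eq hφ (Set.forall_mem_range.2 hagree) (Set.forall_mem_range.2 hmulψ)
      (Set.forall_mem_range.2 hmul) ha hc
  · intro k d _ hk _
    rw [← hφω]
    exact hmul k d
  · intro j k d _ hk hj _
    rw [← hφω, ← hφω]
    change φ (b k * d * star (b j)) = φ (b k) * φ d * star (φ (b j))
    have h := hmul j (star d)
    have hdj : φ (d * star (b j)) = φ d * star (φ (b j)) := by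
      rw [← star_star (d * star (b j)), hφ.apply_star, star_mul, star_star, h, star_mul,
        hφ.apply_star d, star_star]
    rw [mul_assoc, hmul, hdj, mul_assoc]
end
end

section
/- Let B be a unital C*-algebra and let M ⊆ B be a unital subspace. Every state on B that is M-detectable is a pure state (i.e., an extreme point of the state space of B). -/
noncomputable section

open scoped ComplexOrder

variable {B : Type*} [NormedRing B] [StarRing B] [CStarRing B] [NormedAlgebra ℂ B]
  [StarModule ℂ B] [CompleteSpace B]

/-- A pure state on `B`: an extreme point of the convex set of states on `B`. -/
def IsPureState (φ : B →ₗ[ℂ] ℂ) : Prop :=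
  φ ∈ Set.extremePoints ℝ {ψ : B →ₗ[ℂ] ℂ | IsState ψ}

/-- `ω` is `M`-detectable: there is a uniformly bounded net `(a_λ)` in `M` with
`ω(a_λ* a_λ) = 1` for all `λ`, and for every state `ψ ≠ ω` eventually `ψ(a_λ* a_λ) < 1`. -/
def IsDetectableState (M : Set B) (ω : B →ₗ[ℂ] ℂ) : Prop :=
  ∃ (Λ : Type) (_ : Preorder Λ), Nonempty Λ ∧ IsDirected Λ (· ≤ ·) ∧
    ∃ a : Λ → B, (∀ l, a l ∈ M) ∧ (∃ C : ℝ, ∀ l, ‖a l‖ ≤ C) ∧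
      (∀ l, ω (star (a l) * a l) = 1) ∧
      ∀ ψ : B →ₗ[ℂ] ℂ, IsState ψ → ψ ≠ ω →
        ∃ μ, ∀ l, μ ≤ l → ψ (star (a l) * a l) < 1

theorem stmt4 (M : Submodule ℂ B) (h1M : (1 : B) ∈ M)
    (ω : B →ₗ[ℂ] ℂ) (hω : IsState ω) (hdet : IsDetectableState (M : Set B) ω) :
    IsPureState ω := by
  obtain ⟨Λ, _, -, hdir, a, -, -, hωa, hlt⟩ := hdet
  refine ⟨hω, fun φ hφ ψ hψ hseg => ?_⟩
  obtain ⟨s, t, hs, ht, hst, hcomb⟩ := hseg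
  by_contra hne
  have hψne : ψ ≠ ω := by
    rintro rfl
    refine hne (smul_right_injective _ hs.ne' ?_)
    change s • φ = s • ψ
    rw [eq_sub_of_add_eq hcomb, sub_eq_iff_eq_add, ← add_smul, hst, one_smul]
  obtain ⟨μ, hμ⟩ := hlt φ hφ hne
  obtain ⟨ν, hν⟩ := hlt ψ hψ hψne
  obtain ⟨l, hμl, hνl⟩ := hdir.directed μ ν
  have hval : s • φ (star (a l) * a l) + t • ψ (star (a l) * a l) = 1 := by
    rw [← hωa l, ← hcomb]
    rfl
  have hre := congrArg Complex.re hval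
  simp only [Complex.add_re, Complex.smul_re, smul_eq_mul, Complex.one_re] at hre
  have hφre : (φ (star (a l) * a l)).re < 1 := (Complex.lt_def.mp (hμ l hμl)).1
  have hψre : (ψ (star (a l) * a l)).re < 1 := (Complex.lt_def.mp (hν l hνl)).1
  nlinarith [mul_lt_mul_of_pos_left hφre hs, mul_lt_mul_of_pos_left hψre ht]
end
end

section
/- Let B be a unital C*-algebra, let M ⊆ B be a unital subspace, and let ω be a state on B whose restriction to M admits a unique extension to a state on B. Let R = span_ℝ{Re a : a ∈ M} and S = span_ℝ{Re b : b ∈ B} (the real subspace of selfadjoint elements of B). Then the restriction of ω to R admits a unique ℝ-linear contractive extension to S: if ρ' : S → ℝ is ℝ-linear with |ρ'(s)| ≤ ‖s‖ for all s ∈ S and ρ'(r) = ω(r) for all r ∈ R, then ρ'(s) = ω(s) for all s ∈ S. -/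
noncomputable section

open scoped ComplexOrder

variable {B : Type*} [NormedRing B] [StarRing B] [CStarRing B] [NormedAlgebra ℂ B]
  [StarModule ℂ B] [CompleteSpace B]

/-- The real part `(b + b*)/2` of an element of `B`. -/
def reEl (b : B) : B := (2 : ℂ)⁻¹ • (b + star b)

theorem reEl_of_isSelfAdjoint {b : B} (hb : IsSelfAdjoint b) : reEl b = b := by
  rw [reEl, hb.star_eq, ← two_smul ℂ b, smul_smul]
  norm_num

theorem isSelfAdjoint_reEl (b : B) : IsSelfAdjoint (reEl b) := by
  simp [IsSelfAdjoint, reEl, add_comm]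

theorem norm_reEl_le (b : B) : ‖reEl b‖ ≤ ‖b‖ := by
  have h := norm_add_le b (star b)
  rw [norm_star] at h
  rw [reEl, norm_smul, norm_inv, Complex.norm_ofNat]
  linarith

/-- The real part as a real-linear map. -/
def reElLinearMap : B →ₗ[ℝ] B where
  toFun := reEl
  map_add' x y := by
    simp only [reEl, star_add, ← smul_add]
    congr 1
    abel
  map_smul' c x := by
    simp only [reEl, ← Complex.coe_smul, star_smul, Complex.star_def, Complex.conj_ofReal,
      RingHom.id_apply, ← smul_add]
    exact smul_comm _ _ _

/-- A state is real on selfadjoint elements. -/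
theorem IsState.im_eq_zero {ω : B →ₗ[ℂ] ℂ} (hω : IsState ω) {a : B} (ha : IsSelfAdjoint a) :
    (ω a).im = 0 := by
  have : Nontrivial B := ⟨⟨1, 0, fun h => by simpa [h] using hω.1⟩⟩
  have key (t : ℝ) : 2 * (ω a).im * t ≤ ‖a‖ ^ 2 := by
    have h₁ : ‖a + ((t : ℂ) * Complex.I) • (1 : B)‖ ^ 2 ≤ ‖a‖ ^ 2 + t ^ 2 := by
      have hmul : star (a + ((t : ℂ) * Complex.I) • (1 : B)) * (a + ((t : ℂ) * Complex.I) • (1 : B))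
          = a * a + ((t : ℂ) ^ 2) • (1 : B) := by
        have hc : (t * Complex.I) * (t * Complex.I) = -(t : ℂ) ^ 2 := by
          linear_combination (t : ℂ) ^ 2 * Complex.I_mul_I
        simp [ha.star_eq, add_mul, mul_add, smul_smul, hc]
      rw [sq, ← CStarRing.norm_star_mul_self, hmul]
      refine (norm_add_le _ _).trans (add_le_add ?_ ?_)
      · simpa [sq] using norm_mul_le a a
      · simp [norm_smul]
    have h₂ := hω.2 (a + ((t : ℂ) * Complex.I) • (1 : B))
    have h₃ := Complex.abs_im_le_norm (ω (a + ((t : ℂ) * Complex.I) • (1 : B)))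
    have h₄ := (sq_le_sq₀ (abs_nonneg _) (norm_nonneg _)).2 (h₃.trans h₂)
    rw [sq_abs] at h₄
    simp [hω.1] at h₄
    nlinarith [sq_nonneg (ω a).im]
  by_contra h
  have := key ((‖a‖ ^ 2 + 1) / (2 * (ω a).im))
  rw [mul_div_cancel₀ _ (by simpa using h)] at this
  linarith

theorem IsState.re_apply_reEl {ω : B →ₗ[ℂ] ℂ} (hω : IsState ω) (b : B) :
    (ω (reEl b)).re = (ω b).re := by
  have h := hω.im_eq_zero (isSelfAdjoint_reEl (Complex.I • b))
  simp [reEl] at h ⊢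
  linarith

theorem stmt8 (M : Submodule ℂ B) (h1M : (1 : B) ∈ M)
    (ω : B →ₗ[ℂ] ℂ) (hω : IsState ω)
    (huniq : ∀ ω' : B →ₗ[ℂ] ℂ, IsState ω' → (∀ m ∈ M, ω' m = ω m) → ω' = ω)
    (R S : Submodule ℝ B)
    (hR : R = Submodule.span ℝ {x : B | ∃ a ∈ M, x = reEl a})
    (hS : S = Submodule.span ℝ {x : B | ∃ b : B, x = reEl b})
    (ρ' : S →ₗ[ℝ] ℝ)
    (hρcontr : ∀ s : S, |ρ' s| ≤ ‖(s : B)‖)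
    (hρext : ∀ (r : B) (hr : r ∈ R) (hrS : r ∈ S), ρ' ⟨r, hrS⟩ = (ω r).re) :
    ∀ (s : B) (hs : s ∈ S), ρ' ⟨s, hs⟩ = (ω s).re := by
  have hmem (b : B) : reElLinearMap b ∈ S := hS ▸ Submodule.subset_span ⟨b, rfl⟩
  have hsa {s : B} (hs : s ∈ S) : IsSelfAdjoint s := by
    rw [hS] at hs
    induction hs using Submodule.span_induction with
    | mem x hx => obtain ⟨b, rfl⟩ := hx; exact isSelfAdjoint_reEl b
    | zero => exact .zero B
    | add x y _ _ hx hy => exact hx.add hy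
    | smul c x _ hx =>
      rw [← Complex.coe_smul]
      exact IsSelfAdjoint.smul (Complex.conj_ofReal c) hx
  let f : Module.Dual ℝ B := ρ' ∘ₗ reElLinearMap.codRestrict S hmem
  have hf_le (b : B) : |f b| ≤ ‖b‖ := (hρcontr _).trans (norm_reEl_le b)
  have hf_M {m : B} (hm : m ∈ M) : f m = (ω m).re :=
    (hρext _ (hR ▸ Submodule.subset_span ⟨m, hm, rfl⟩) (hmem m)).trans (hω.re_apply_reEl m)
  let φ : B →ₗ[ℂ] ℂ := f.extendRCLike
  have hφ_re (b : B) : (φ b).re = f b := Module.Dual.re_extendRCLike_apply (𝕜 := ℂ) f b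
  have hφ_M (m : B) (hm : m ∈ M) : φ m = ω m := by
    have h := hf_M (M.smul_mem Complex.I hm)
    have him : (φ m).im = -f (Complex.I • m) := Module.Dual.im_extendRCLike_apply (𝕜 := ℂ) f m
    refine Complex.ext ((hφ_re m).trans (hf_M hm)) ?_
    simp [him, h]
  have hφ : IsState φ := by
    refine ⟨(hφ_M 1 h1M).trans hω.1, fun b => ?_⟩
    have hsq : ‖φ b‖ ^ 2 ≤ ‖φ b‖ * ‖b‖ := by
      refine (Module.Dual.norm_extendRCLike_apply_sq (𝕜 := ℂ) f b).le.trans ?_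
      refine (le_abs_self _).trans ((hf_le _).trans ?_)
      rw [norm_smul, RCLike.norm_conj]
    nlinarith [norm_nonneg (φ b), norm_nonneg b]
  intro s hs
  rw [← huniq φ hφ hφ_M, hφ_re]
  exact congrArg ρ' (Subtype.ext (reEl_of_isSelfAdjoint (hsa hs)).symm)
end
end

section
/- Let B be a unital C*-algebra and let ω be a pure state on B. Let K be a weak-* compact subset of the state space S(B) with ω ∉ K. Then there exist a real number γ with 0 < γ < 1 and an element f ∈ B with 0 ≤ f ≤ 1 and ω(f) = 1 such that ψ(f) < γ for every ψ ∈ K. -/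
noncomputable section

open scoped ComplexOrder

variable {B : Type*} [NormedRing B] [StarRing B] [CStarRing B] [NormedAlgebra ℂ B]
  [StarModule ℂ B] [CompleteSpace B]

/-- A state on `B`, as a (weak-*) continuous linear functional: unital and contractive. -/
def IsStateW (φ : WeakDual ℂ B) : Prop :=
  φ 1 = 1 ∧ ∀ b : B, ‖φ b‖ ≤ ‖b‖

/-- The state space of `B`, inside the weak-* dual. -/
def stateSpace (B : Type*) [NormedRing B] [StarRing B] [CStarRing B] [NormedAlgebra ℂ B]
    [StarModule ℂ B] [CompleteSpace B] : Set (WeakDual ℂ B) :=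
  {φ | IsStateW φ}

/-- A pure state on `B`: an extreme point of the state space. -/
def IsPureStateW (φ : WeakDual ℂ B) : Prop :=
  φ ∈ Set.extremePoints ℝ (stateSpace B)

theorem convex_stateSpace : Convex ℝ (stateSpace B) := by
  intro φ hφ ψ hψ s t hs ht hst
  refine ⟨?_, fun b ↦ ?_⟩
  · change s • φ 1 + t • ψ 1 = 1
    rw [hφ.1, hψ.1, ← add_smul, hst, one_smul]
  · change ‖s • φ b + t • ψ b‖ ≤ ‖b‖
    refine (norm_add_le _ _).trans ?_
    rw [norm_smul, norm_smul, Real.norm_of_nonneg hs, Real.norm_of_nonneg ht]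
    calc _ ≤ s * ‖b‖ + t * ‖b‖ := by gcongr; exacts [hφ.2 b, hψ.2 b]
      _ = ‖b‖ := by rw [← add_mul, hst, one_mul]

theorem isCompact_stateSpace : IsCompact (stateSpace B) := by
  have h : stateSpace B = {φ : WeakDual ℂ B | φ 1 = 1} ∩
      WeakDual.toStrongDual ⁻¹' Metric.closedBall (0 : StrongDual ℂ B) 1 := by
    ext φ
    simp only [stateSpace, IsStateW, Set.mem_ofPred_eq, Set.mem_inter_iff, Set.mem_preimage,
      mem_closedBall_zero_iff, ContinuousLinearMap.opNorm_le_iff zero_le_one, one_mul]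
    rfl
  rw [h]
  exact (WeakDual.isCompact_closedBall 0 1).inter_left
    (isClosed_eq (WeakDual.eval_continuous 1) continuous_const)


theorem WeakDual.continuousSMul_real {E : Type*} [NormedAddCommGroup E] [NormedSpace ℂ E] :
    ContinuousSMul ℝ (WeakDual ℂ E) :=
  ⟨WeakDual.continuous_of_continuous_eval fun a ↦
    continuous_fst.smul ((WeakDual.eval_continuous a).comp continuous_snd)⟩

/-- A minimax principle, obtained from Sion's theorem: if at each point of a compact convex set `X`
the bound `c` is beaten by some `a`, then some `a` beats it on all of `X`. -/
theorem IsCompact.exists_forall_lt {E V : Type*} [TopologicalSpace E] [AddCommGroup E] [Module ℝ E]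
    [IsTopologicalAddGroup E] (hsmul : ContinuousSMul ℝ E) [TopologicalSpace V] [AddCommGroup V]
    [Module ℝ V] [IsTopologicalAddGroup V] [ContinuousSMul ℝ V] {X : Set E} (hX : IsCompact X)
    (hXc : Convex ℝ X) (hne : X.Nonempty) {F : E → V → ℝ} {c : ℝ}
    (hF : ∀ a, Continuous fun x ↦ F x a) (hF' : ∀ x ∈ X, Continuous (F x))
    (hconv : ∀ a, ConvexOn ℝ X fun x ↦ F x a) (hconc : ∀ x ∈ X, ConcaveOn ℝ Set.univ (F x))
    (h : ∀ x ∈ X, ∃ a, c < F x a) : ∃ a, ∀ x ∈ X, c < F x a := by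
  obtain ⟨s, hs⟩ := hX.elim_finite_subcover (fun a ↦ {x | c < F x a})
    (fun a ↦ isOpen_lt continuous_const (hF a)) fun x hx ↦ by simpa using h x hx
  obtain ⟨a, -, ha⟩ := Sion.exists_lt_iInf_of_lt_iInf_of_finite (X := X)
    (Y := Set.univ) (f := F) (t := c) hne hX
    (fun a _ ↦ (hF a).lowerSemicontinuous.lowerSemicontinuousOn _)
    (fun a _ ↦ (hconv a).quasiconvexOn) convex_univ
    (fun x hx ↦ (hF' x hx).upperSemicontinuous.upperSemicontinuousOn _)
    (fun x hx ↦ (hconc x hx).quasiconcaveOn) hXc s.finite_toSet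
    (Set.subset_univ _) fun x hx ↦ by simpa using hs hx
  exact ⟨a, ha⟩
section PositiveFunctionals

open scoped InnerProductSpace
open UniformSpace

variable {A : Type*} [CStarAlgebra A] [PartialOrder A] [StarOrderedRing A]

namespace PositiveLinearMap

/-- The quadratic form `a ↦ f (a⋆a)` of a positive functional. -/
def quad (f : A →ₚ[ℂ] ℂ) (a : A) : ℝ := (f (star a * a)).re

theorem coe_quad (f : A →ₚ[ℂ] ℂ) (a : A) : (f.quad a : ℂ) = f (star a * a) :=
  (Complex.eq_re_of_ofReal_le (f.map_nonneg (star_mul_self_nonneg a))).symm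

theorem norm_toPreGNS_sq (f : A →ₚ[ℂ] ℂ) (a : A) : ‖f.toPreGNS a‖ ^ 2 = f.quad a := by
  exact_mod_cast (f.preGNS_norm_sq (f.toPreGNS a)).trans (f.coe_quad a).symm

theorem quad_nonneg (f : A →ₚ[ℂ] ℂ) (a : A) : 0 ≤ f.quad a :=
  f.norm_toPreGNS_sq a ▸ sq_nonneg _

theorem norm_toPreGNS (f : A →ₚ[ℂ] ℂ) (a : A) : ‖f.toPreGNS a‖ = √(f.quad a) := by
  rw [← norm_toPreGNS_sq, Real.sqrt_sq (norm_nonneg _)]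

theorem convexOn_quad (f : A →ₚ[ℂ] ℂ) : ConvexOn ℝ Set.univ f.quad := by
  have h : ConvexOn ℝ Set.univ (fun x : f.PreGNS ↦ ‖x‖ ^ 2) :=
    convexOn_univ_norm.pow (fun _ _ ↦ norm_nonneg _) 2
  have := h.comp_linearMap (f.toPreGNS.toLinearMap.restrictScalars ℝ)
  simpa [Function.comp_def, norm_toPreGNS_sq] using this

theorem continuous_quad (f : A →ₚ[ℂ] ℂ) : Continuous f.quad := by
  have : Continuous f := map_continuous f
  unfold quad
  fun_prop

/-- The Cauchy–Schwarz inequality for positive functionals. -/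
theorem norm_apply_star_mul_le (f : A →ₚ[ℂ] ℂ) (a b : A) :
    ‖f (star a * b)‖ ≤ √(f.quad a) * √(f.quad b) := by
  rw [← norm_toPreGNS, ← norm_toPreGNS]
  exact norm_inner_le_norm (𝕜 := ℂ) (f.toPreGNS a) (f.toPreGNS b)

theorem norm_apply_le_sqrt_quad (f : A →ₚ[ℂ] ℂ) (a : A) :
    ‖f a‖ ≤ √(f 1).re * √(f.quad a) := by
  simpa [quad] using f.norm_apply_star_mul_le 1 a

theorem quad_le (f : A →ₚ[ℂ] ℂ) (hf : f 1 = 1) (a : A) : f.quad a ≤ ‖a‖ ^ 2 := by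
  have h := f.norm_apply_le_of_nonneg _ (star_mul_self_nonneg a)
  rw [hf, norm_one, one_mul, CStarRing.norm_star_mul_self, ← sq] at h
  exact (Complex.re_le_norm _).trans h

theorem norm_apply_le (f : A →ₚ[ℂ] ℂ) (hf : f 1 = 1) (a : A) : ‖f a‖ ≤ ‖a‖ := by
  have h := f.norm_apply_le_sqrt_quad a
  rw [hf, Complex.one_re, Real.sqrt_one, one_mul] at h
  exact h.trans (Real.sqrt_le_iff.2 ⟨norm_nonneg a, f.quad_le hf a⟩)

theorem quad_add (f : A →ₚ[ℂ] ℂ) (a b : A) :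
    f.quad (a + b) = f.quad a + 2 * (f (star a * b)).re + f.quad b := by
  have h : f (star b * a) = star (f (star a * b)) := by rw [← map_star, star_mul, star_star]
  simp [quad, add_mul, mul_add, h]
  ring

theorem quad_sub (f : A →ₚ[ℂ] ℂ) (a b : A) :
    f.quad (a - b) = f.quad a - 2 * (f (star a * b)).re + f.quad b := by
  have := f.quad_add a (-b)
  simpa [quad, ← sub_eq_add_neg] using this

theorem sqrt_quad_add_le (f : A →ₚ[ℂ] ℂ) (a b : A) :
    √(f.quad (a + b)) ≤ √(f.quad a) + √(f.quad b) := by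
  simpa [← norm_toPreGNS] using norm_add_le (f.toPreGNS a) (f.toPreGNS b)

/-- A positive functional on which every positive functional it dominates is a multiple of it. -/
def IsMinimal (f : A →ₚ[ℂ] ℂ) : Prop :=
  ∀ (g : A →ₚ[ℂ] ℂ) (C : ℝ), (∀ a, g.quad a ≤ C * f.quad a) → ∀ a, g a = g 1 * f a

/-- If `f ≤ s` then `f` is represented in the GNS space of `s` as `f a = ⟪v, a⟫`. -/
theorem exists_vector_of_quad_le (f s : A →ₚ[ℂ] ℂ) (h : ∀ a, f.quad a ≤ s.quad a) :
    ∃ v : s.GNS, ∀ a : A, ⟪v, (s.toPreGNS a : s.GNS)⟫_ℂ = f a := by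
  let ℓ : s.PreGNS →ₗ[ℂ] ℂ := f.toLinearMap ∘ₗ s.ofPreGNS.toLinearMap
  let e : s.PreGNS →ₗ[ℂ] s.GNS := (Completion.toComplL (𝕜 := ℂ) (E := s.PreGNS)).toLinearMap
  have hd : DenseRange e := Completion.denseRange_coe
  have hb : ∃ C, ∀ x, ‖ℓ x‖ ≤ C * ‖e x‖ := by
    refine ⟨√(f 1).re, fun x ↦ ?_⟩
    have he : ‖e x‖ = √(s.quad (s.ofPreGNS x)) := by
      rw [← norm_toPreGNS]
      exact Completion.norm_coe _
    rw [he]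
    refine (f.norm_apply_le_sqrt_quad (s.ofPreGNS x)).trans ?_
    gcongr
    exact h _
  refine ⟨(InnerProductSpace.toDual ℂ s.GNS).symm (ℓ.extendOfNorm e), fun a ↦ ?_⟩
  rw [InnerProductSpace.toDual_symm_apply]
  exact LinearMap.extendOfNorm_eq hd hb (s.toPreGNS a)

/-- The positive functional attached to a vector of a GNS space. -/
def vectorFunctional (s : A →ₚ[ℂ] ℂ) (v : s.GNS) : A →ₚ[ℂ] ℂ :=
  mk₀ { toFun := fun a ↦ ⟪v, s.gnsStarAlgHom a v⟫_ℂ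
        map_add' := fun a b ↦ by rw [map_add, _root_.add_apply, inner_add_right]
        map_smul' := fun c a ↦ by
          rw [map_smul, smul_apply, inner_smul_right]; rfl }
    fun x hx ↦ by
      obtain ⟨c, rfl⟩ := CStarAlgebra.nonneg_iff_eq_star_mul_self.mp hx
      change 0 ≤ ⟪v, s.gnsStarAlgHom (star c * c) v⟫_ℂ
      rw [map_mul, map_star, mul_apply_eq_comp, ContinuousLinearMap.star_eq_adjoint,
        ContinuousLinearMap.adjoint_inner_right, inner_self_eq_norm_sq_to_K,
        RCLike.ofReal_eq_complex_ofReal]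
      exact_mod_cast sq_nonneg ‖s.gnsStarAlgHom c v‖

theorem vectorFunctional_apply (s : A →ₚ[ℂ] ℂ) (v : s.GNS) (a : A) :
    s.vectorFunctional v a = ⟪v, s.gnsStarAlgHom a v⟫_ℂ := rfl

theorem quad_vectorFunctional (s : A →ₚ[ℂ] ℂ) (v : s.GNS) (a : A) :
    (s.vectorFunctional v).quad a = ‖s.gnsStarAlgHom a v‖ ^ 2 := by
  rw [quad, vectorFunctional_apply, map_mul, map_star, mul_apply_eq_comp,
    ContinuousLinearMap.star_eq_adjoint, ContinuousLinearMap.adjoint_inner_right,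
    inner_self_eq_norm_sq_to_K]
  norm_cast

theorem inner_gnsStarAlgHom (s : A →ₚ[ℂ] ℂ) (v : s.GNS) (b a : A) :
    ⟪s.gnsStarAlgHom b v, (s.toPreGNS a : s.GNS)⟫_ℂ =
      ⟪v, (s.toPreGNS (star b * a) : s.GNS)⟫_ℂ := by
  rw [← ContinuousLinearMap.adjoint_inner_right, ← ContinuousLinearMap.star_eq_adjoint,
    ← map_star]
  congr 1
  exact s.gnsNonUnitalStarAlgHom_apply_coe

theorem IsMinimal.exists_quad_sub_add_quad_lt {f : A →ₚ[ℂ] ℂ} (hf : f.IsMinimal) (h1 : f 1 = 1)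
    (g : A →ₚ[ℂ] ℂ) (hg : g 1 = 1) (b : A) {ε : ℝ} (hε : 0 < ε) :
    ∃ a, f.quad (b - a) + g.quad a < f.quad b / 2 + ε := by
  set s : A →ₚ[ℂ] ℂ := f + g with hs
  have hsq (a : A) : s.quad a = f.quad a + g.quad a := by simp [quad, hs]
  obtain ⟨v, hv⟩ := exists_vector_of_quad_le f s fun a ↦ by
    rw [hsq]; linarith [g.quad_nonneg a]
  have hbv (b a : A) :
      ⟪s.gnsStarAlgHom b v, (s.toPreGNS a : s.GNS)⟫_ℂ = f (star b * a) := by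
    rw [inner_gnsStarAlgHom, hv]
  have hle (b : A) : (s.vectorFunctional v).quad b ≤ 1 * f.quad b := by
    have key (x : s.GNS) : ‖⟪s.gnsStarAlgHom b v, x⟫_ℂ‖ ≤ √(f.quad b) * ‖x‖ := by
      induction x using Completion.induction_on with
      | hp => apply isClosed_le <;> fun_prop
      | ih x =>
        obtain ⟨a, rfl⟩ := s.toPreGNS.surjective x
        rw [hbv, Completion.norm_coe, norm_toPreGNS]
        refine (f.norm_apply_star_mul_le _ _).trans ?_
        gcongr
        rw [hsq]
        linarith [g.quad_nonneg a]
    have h := key (s.gnsStarAlgHom b v)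
    rw [inner_self_eq_norm_sq_to_K] at h
    rw [quad_vectorFunctional, one_mul]
    have h2 : ‖s.gnsStarAlgHom b v‖ ^ 2 ≤ √(f.quad b) * ‖s.gnsStarAlgHom b v‖ := by
      simpa using h
    have h3 : ‖s.gnsStarAlgHom b v‖ ≤ √(f.quad b) := by
      by_contra! hc
      nlinarith [Real.sqrt_nonneg (f.quad b)]
    calc _ ≤ √(f.quad b) ^ 2 := by gcongr
      _ = _ := Real.sq_sqrt (f.quad_nonneg b)
  have hmul := hf _ 1 hle
  have hμ : s.vectorFunctional v 1 = ((‖v‖ ^ 2 : ℝ) : ℂ) := by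
    rw [vectorFunctional_apply, map_one, one_apply_eq_self,
      inner_self_eq_norm_sq_to_K]
    norm_cast
  have hquad : ‖s.gnsStarAlgHom b v‖ ^ 2 = ‖v‖ ^ 2 * f.quad b := by
    rw [← quad_vectorFunctional, quad, hmul, hμ, Complex.re_ofReal_mul, quad]
  have hhalf : 1 / 2 ≤ ‖v‖ ^ 2 := by
    have h := norm_inner_le_norm (𝕜 := ℂ) v (s.toPreGNS 1 : s.GNS)
    rw [hv, h1, norm_one, Completion.norm_coe, norm_toPreGNS, hsq] at h
    have h2 : f.quad 1 + g.quad 1 = 2 := by norm_num [quad, h1, hg]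
    rw [h2] at h
    nlinarith [Real.sq_sqrt (zero_le_two (α := ℝ)), norm_nonneg v, Real.sqrt_nonneg 2]
  obtain ⟨x, hx⟩ : ∃ x : s.PreGNS, ‖(x : s.GNS) - s.gnsStarAlgHom b v‖ ^ 2 < ε :=
    Completion.denseRange_coe.exists_mem_open
      (s := {y : s.GNS | ‖y - s.gnsStarAlgHom b v‖ ^ 2 < ε})
      (isOpen_lt (by fun_prop) (by fun_prop)) ⟨s.gnsStarAlgHom b v, by simpa using hε⟩
  obtain ⟨a, rfl⟩ := s.toPreGNS.surjective x
  refine ⟨a, ?_⟩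
  rw [norm_sub_rev, @norm_sub_sq ℂ, hbv, Completion.norm_coe, norm_toPreGNS_sq, hsq, hquad] at hx
  rw [quad_sub]
  simp only [RCLike.re_to_complex] at hx
  nlinarith [f.quad_nonneg b]

end PositiveLinearMap

theorem IsStateW.apply_nonneg {φ : WeakDual ℂ A} (hφ : IsStateW φ) {x : A} (hx : 0 ≤ x) :
    0 ≤ φ x := by
  have hsa : star x = x := (IsSelfAdjoint.of_nonneg hx).star_eq
  have h1 : ‖(1 : A)‖ ≤ 1 := by
    rcases subsingleton_or_nontrivial A with h | h
    · simp [Subsingleton.elim (1 : A) 0]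
    · simp
  have him : (φ x).im = 0 := by
    have key (t : ℝ) : ((φ x).im + t) ^ 2 ≤ ‖x‖ ^ 2 + t ^ 2 := by
      have h2 : φ (x + (t * Complex.I : ℂ) • 1) = φ x + t * Complex.I := by simp [hφ.1]
      have h3 : star (x + (t * Complex.I : ℂ) • (1 : A)) * (x + (t * Complex.I : ℂ) • 1) =
          x * x + ((t ^ 2 : ℝ) : ℂ) • 1 := by
        simp only [star_add, hsa, star_smul, star_one, add_mul, mul_add, smul_mul_assoc,
          mul_smul_comm, mul_one, one_mul]
        simp only [star_mul', RCLike.star_def, Complex.conj_ofReal, Complex.conj_I]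
        have : (t * -Complex.I : ℂ) * (t * Complex.I) = ((t ^ 2 : ℝ) : ℂ) := by
          push_cast; linear_combination (-t ^ 2 : ℂ) * Complex.I_sq
        rw [← this, smul_add, smul_smul, neg_eq_neg_one_mul Complex.I]
        module
      have h4 : ‖x + (t * Complex.I : ℂ) • (1 : A)‖ ^ 2 ≤ ‖x‖ ^ 2 + t ^ 2 := by
        rw [sq, ← CStarRing.norm_star_mul_self, h3]
        refine (norm_add_le _ _).trans (add_le_add ((norm_mul_le _ _).trans_eq (sq _).symm) ?_)
        rw [norm_smul, Complex.norm_real, Real.norm_of_nonneg (sq_nonneg t)]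
        exact mul_le_of_le_one_right (sq_nonneg t) h1
      have h5 := hφ.2 (x + (t * Complex.I : ℂ) • 1)
      rw [h2] at h5
      have h6 : |(φ x).im + t| ≤ ‖φ x + t * Complex.I‖ := by
        simpa using Complex.abs_im_le_norm (φ x + t * Complex.I)
      calc ((φ x).im + t) ^ 2 = |(φ x).im + t| ^ 2 := (sq_abs _).symm
        _ ≤ ‖x + (t * Complex.I : ℂ) • (1 : A)‖ ^ 2 := by gcongr; exact h6.trans h5
        _ ≤ _ := h4
    by_contra h0
    have h := key ((‖x‖ ^ 2 + 1) / (2 * (φ x).im))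
    have h7 : 2 * (φ x).im * ((‖x‖ ^ 2 + 1) / (2 * (φ x).im)) = ‖x‖ ^ 2 + 1 := by
      field_simp
    nlinarith [sq_nonneg (φ x).im]
  refine Complex.nonneg_iff.2 ⟨?_, him.symm⟩
  have hle : ‖algebraMap ℝ A ‖x‖ - x‖ ≤ ‖x‖ := by
    have h2 : 0 ≤ algebraMap ℝ A ‖x‖ - x :=
      sub_nonneg.2 (IsSelfAdjoint.le_algebraMap_norm_self (.of_nonneg hx))
    rw [CStarAlgebra.norm_le_iff_le_algebraMap _ (norm_nonneg x) h2]
    exact sub_le_self _ hx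
  have h3 : φ (algebraMap ℝ A ‖x‖ - x) = ‖x‖ - φ x := by
    rw [map_sub, Algebra.algebraMap_eq_smul_one, ← Complex.coe_smul, map_smul, hφ.1]
    simp
  have h4 := (Complex.re_le_norm _).trans ((hφ.2 (algebraMap ℝ A ‖x‖ - x)).trans hle)
  rw [h3] at h4
  simpa using h4

/-- A state, as a positive linear functional. -/
def IsStateW.toPositive {φ : WeakDual ℂ A} (hφ : IsStateW φ) : A →ₚ[ℂ] ℂ :=
  PositiveLinearMap.mk₀ (WeakDual.toStrongDual φ).toLinearMap fun _ hx ↦ hφ.apply_nonneg hx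

theorem IsStateW.toPositive_apply {φ : WeakDual ℂ A} (hφ : IsStateW φ) (a : A) :
    hφ.toPositive a = φ a := rfl

theorem IsStateW.toPositive_one {φ : WeakDual ℂ A} (hφ : IsStateW φ) : hφ.toPositive 1 = 1 :=
  hφ.1

theorem PositiveLinearMap.exists_isStateW (f : A →ₚ[ℂ] ℂ) (hf : f 1 = 1) :
    ∃ φ : WeakDual ℂ A, IsStateW φ ∧ ∀ a, φ a = f a :=
  ⟨StrongDual.toWeakDual (f.toLinearMap.mkContinuous 1 fun a ↦ by
    simpa using f.norm_apply_le hf a), ⟨hf, f.norm_apply_le hf⟩, fun _ ↦ rfl⟩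

/-- The norm of a positive element is attained by a state. -/
theorem exists_isStateW_apply_eq_norm [Nontrivial A] {x : A} (hx : 0 ≤ x) :
    ∃ φ : WeakDual ℂ A, IsStateW φ ∧ φ x = ‖x‖ := by
  have hn : ‖1 + x‖ = 1 + ‖x‖ := by
    refine le_antisymm ((norm_add_le _ _).trans_eq (by rw [norm_one])) ?_
    have h0 : 0 ≤ 1 + x := add_nonneg zero_le_one hx
    have h := CStarAlgebra.norm_mem_spectrum_of_nonneg hx
    have h2 : 1 + ‖x‖ ∈ spectrum ℝ (1 + x) := by
      simpa [add_comm] using spectrum.add_mem_add_iff (r := ‖x‖) (s := 1) (a := x) |>.2 h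
    exact (le_abs_self _).trans (spectrum.norm_le_norm_of_mem h2)
  obtain ⟨g, hg, hgx⟩ := exists_dual_vector'' ℂ (1 + x)
  have hb (a : A) : ‖g a‖ ≤ ‖a‖ := by simpa using g.le_of_opNorm_le hg a
  rw [hn, map_add] at hgx
  have hgx' : g 1 + g x = 1 + ‖x‖ := by simpa using hgx
  have h1 := hb 1
  rw [norm_one] at h1
  have h2 := hb x
  have hre := congrArg Complex.re hgx'
  simp only [Complex.add_re, Complex.one_re, Complex.ofReal_re] at hre
  have h3 : (g 1).re = 1 := by linarith [Complex.re_le_norm (g 1), Complex.re_le_norm (g x)]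
  have h4 : g 1 = 1 := by
    have h5 : ‖g 1‖ ^ 2 ≤ 1 := by nlinarith [norm_nonneg (g 1)]
    rw [← Complex.normSq_eq_norm_sq, Complex.normSq_apply, h3] at h5
    refine Complex.ext h3 ?_
    have : (g 1).im ^ 2 = 0 := by nlinarith [sq_nonneg (g 1).im]
    simpa using this
  refine ⟨StrongDual.toWeakDual g, ⟨h4, hb⟩, ?_⟩
  change g x = _
  rw [h4] at hgx'
  exact add_left_cancel hgx'

theorem IsPureStateW.eq_of_quad_le {ω τ : WeakDual ℂ A} (hω : IsPureStateW ω) (hτ : IsStateW τ)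
    (C : ℝ) (h : ∀ a, hτ.toPositive.quad a ≤ C * hω.1.toPositive.quad a) : τ = ω := by
  set D : ℝ := max C 0 + 2 with hD
  have hD2 : 2 ≤ D := by rw [hD]; linarith [le_max_right C 0]
  have hle (a : A) : hτ.toPositive.quad a ≤ D * hω.1.toPositive.quad a := by
    refine (h a).trans ?_
    gcongr
    · exact hω.1.toPositive.quad_nonneg a
    · rw [hD]; linarith [le_max_left C 0]
  have hD1 : 0 < D - 1 := by linarith
  let χ : WeakDual ℂ A := (D - 1)⁻¹ • (D • ω - τ)
  have hχ (a : A) : χ a = ((D - 1)⁻¹ : ℝ) * (D * ω a - τ a) := by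
    change (D - 1)⁻¹ • (D • ω a - τ a) = _
    simp only [Complex.real_smul]
  let f : A →ₚ[ℂ] ℂ := PositiveLinearMap.mk₀ (WeakDual.toStrongDual χ).toLinearMap fun x hx ↦ by
    change 0 ≤ χ x
    obtain ⟨c, rfl⟩ := CStarAlgebra.nonneg_iff_eq_star_mul_self.mp hx
    rw [hχ, ← hω.1.toPositive_apply, ← hτ.toPositive_apply, ← PositiveLinearMap.coe_quad,
      ← PositiveLinearMap.coe_quad]
    exact_mod_cast mul_nonneg (inv_nonneg.2 hD1.le) (sub_nonneg.2 (hle c))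
  have hf : f 1 = 1 := by
    change χ 1 = 1
    rw [hχ, hω.1.1, hτ.1]
    have : (D : ℂ) - 1 ≠ 0 := by exact_mod_cast hD1.ne'
    push_cast
    field_simp
  have hχs : χ ∈ stateSpace A := ⟨hf, f.norm_apply_le hf⟩
  refine (mem_extremePoints.1 hω).2 τ hτ χ hχs ⟨D⁻¹, 1 - D⁻¹, by positivity, ?_, by ring, ?_⟩ |>.1
  · have : D⁻¹ ≤ 2⁻¹ := inv_anti₀ two_pos hD2
    linarith
  · refine DFunLike.ext _ _ fun a ↦ ?_
    change D⁻¹ • τ a + (1 - D⁻¹) • χ a = ω a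
    have h0 : (D : ℂ) ≠ 0 := by exact_mod_cast (by linarith : D ≠ 0)
    have h1 : (D : ℂ) - 1 ≠ 0 := by exact_mod_cast hD1.ne'
    rw [hχ, Complex.real_smul, Complex.real_smul]
    push_cast
    field_simp
    ring

theorem IsPureStateW.isMinimal {ω : WeakDual ℂ A} (hω : IsPureStateW ω) :
    hω.1.toPositive.IsMinimal := by
  intro g C hg a
  have h1 : g 1 = (g.quad 1 : ℂ) := by simp [g.coe_quad]
  rcases (g.quad_nonneg 1).eq_or_lt with h0 | h0
  · have h := g.norm_apply_le_sqrt_quad a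
    rw [h1, ← h0] at h
    rw [h1, ← h0, Complex.ofReal_zero, zero_mul]
    simpa using h
  · let f : A →ₚ[ℂ] ℂ := PositiveLinearMap.mk₀ (((g.quad 1)⁻¹ : ℝ) • g.toLinearMap) fun x hx ↦ by
      change 0 ≤ (g.quad 1)⁻¹ • g x
      exact smul_nonneg (inv_nonneg.2 h0.le) (g.map_nonneg hx)
    have hfa (x : A) : f x = ((g.quad 1)⁻¹ : ℝ) * g x := by
      change (g.quad 1)⁻¹ • g x = _
      rw [Complex.real_smul]
    have hne : (g.quad 1 : ℂ) ≠ 0 := by exact_mod_cast h0.ne'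
    have hf : f 1 = 1 := by
      rw [hfa, h1]; push_cast; exact inv_mul_cancel₀ hne
    obtain ⟨τ, hτ, hτf⟩ := f.exists_isStateW hf
    have := hω.eq_of_quad_le hτ ((g.quad 1)⁻¹ * C) fun x ↦ by
      have hx : hτ.toPositive.quad x = (g.quad 1)⁻¹ * g.quad x := by
        rw [PositiveLinearMap.quad, hτ.toPositive_apply, hτf, hfa, Complex.re_ofReal_mul]
        rfl
      rw [hx, mul_assoc]
      gcongr
      exact hg x
    rw [hω.1.toPositive_apply, ← this, hτf, hfa, h1]
    push_cast
    field_simp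

/-- A quantitative form of Kadison's transitivity theorem, before passing to the limit. -/
theorem IsPureStateW.exists_quad_sub_add_norm_sq_lt [Nontrivial A] {ω : WeakDual ℂ A}
    (hω : IsPureStateW ω) (b : A) {ε : ℝ} (hε : 0 < ε) :
    ∃ a, hω.1.toPositive.quad (b - a) + ‖a‖ ^ 2 < hω.1.toPositive.quad b / 2 + ε := by
  set f := hω.1.toPositive
  set c := f.quad b / 2 + ε
  let F : WeakDual ℂ A → A → ℝ := fun ρ a ↦ -(f.quad (b - a) + (ρ (star a * a)).re)
  have hcont (a : A) : Continuous fun ρ ↦ F ρ a :=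
    (continuous_const.add
      (Complex.continuous_re.comp (WeakDual.eval_continuous (star a * a)))).neg
  have hpt (ρ : WeakDual ℂ A) (hρ : ρ ∈ stateSpace A) : ∃ a, -c < F ρ a := by
    obtain ⟨a, ha⟩ := hω.isMinimal.exists_quad_sub_add_quad_lt hω.1.toPositive_one
      (IsStateW.toPositive hρ) (IsStateW.toPositive_one hρ) b hε
    exact ⟨a, neg_lt_neg ha⟩
  have hconc (ρ : WeakDual ℂ A) (hρ : ρ ∈ stateSpace A) : ConcaveOn ℝ Set.univ (F ρ) := by
    have h1 : ConvexOn ℝ Set.univ fun a ↦ f.quad (b - a) := by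
      refine ⟨convex_univ, fun x _ y _ s t hs ht hst ↦ ?_⟩
      have h := f.convexOn_quad.2 (Set.mem_univ (b - x)) (Set.mem_univ (b - y)) hs ht hst
      have hb : b - (s • x + t • y) = s • (b - x) + t • (b - y) := by
        have : b = s • b + t • b := by rw [← add_smul, hst, one_smul]
        nth_rewrite 1 [this]
        module
      change f.quad (b - (s • x + t • y)) ≤ s • f.quad (b - x) + t • f.quad (b - y)
      rw [hb]
      exact h
    exact (h1.add (IsStateW.toPositive hρ).convexOn_quad).neg
  obtain ⟨a, ha⟩ := isCompact_stateSpace.exists_forall_lt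
    WeakDual.continuousSMul_real convex_stateSpace
    (F := F) ⟨ω, hω.1⟩ hcont
    (fun ρ _ ↦ by
      have := f.continuous_quad
      have := ρ.continuous
      fun_prop)
    (fun a ↦ ⟨convex_stateSpace, fun ρ _ σ _ s t _ _ hst ↦ by
      change -(f.quad (b - a) + (s • ρ (star a * a) + t • σ (star a * a)).re) ≤
        s * F ρ a + t * F σ a
      simp only [F, Complex.add_re, Complex.real_smul, Complex.re_ofReal_mul]
      exact le_of_eq (by linear_combination f.quad (b - a) * hst)⟩)
    hconc hpt
  obtain ⟨ρ, hρ, hρa⟩ := exists_isStateW_apply_eq_norm (star_mul_self_nonneg a)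
  refine ⟨a, ?_⟩
  have h := ha ρ hρ
  simp only [F, hρa, Complex.ofReal_re, CStarRing.norm_star_mul_self] at h
  rw [sq]
  linarith

theorem IsPureStateW.exists_quad_sub_le [Nontrivial A] {ω : WeakDual ℂ A}
    (hω : IsPureStateW ω) (b : A) :
    ∃ a, hω.1.toPositive.quad (b - a) ≤ (9 / 10) ^ 2 * hω.1.toPositive.quad b ∧
      ‖a‖ ≤ √(hω.1.toPositive.quad b) := by
  rcases (hω.1.toPositive.quad_nonneg b).eq_or_lt with h0 | h0
  · exact ⟨0, by simp [← h0]⟩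
  · obtain ⟨a, ha⟩ := hω.exists_quad_sub_add_norm_sq_lt b (ε := hω.1.toPositive.quad b / 4)
      (by positivity)
    refine ⟨a, ?_, Real.le_sqrt_of_sq_le ?_⟩
    · nlinarith [sq_nonneg ‖a‖]
    · nlinarith [hω.1.toPositive.quad_nonneg (b - a)]

/-- Modulo the left kernel of a pure state `ω`, each `b` has norm at most a constant times
its seminorm `√(ω (b⋆b))`. -/
theorem IsPureStateW.exists_quad_sub_eq_zero [Nontrivial A] {ω : WeakDual ℂ A}
    (hω : IsPureStateW ω) (b : A) :
    ∃ a, hω.1.toPositive.quad (b - a) = 0 ∧ ‖a‖ ≤ 10 * √(hω.1.toPositive.quad b) := by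
  set f := hω.1.toPositive
  choose g hg hgn using hω.exists_quad_sub_le
  let r : ℕ → A := fun n ↦ (fun x ↦ x - g x)^[n] b
  have hr (n : ℕ) : r (n + 1) = r n - g (r n) := Function.iterate_succ_apply' _ _ _
  have hq (n : ℕ) : √(f.quad (r n)) ≤ √(f.quad b) * (9 / 10) ^ n := by
    induction n with
    | zero => rw [pow_zero, mul_one]; rfl
    | succ n ih =>
      rw [hr]
      refine (Real.sqrt_le_sqrt (hg (r n))).trans ?_
      rw [Real.sqrt_mul (by positivity), Real.sqrt_sq (by norm_num), pow_succ]
      nlinarith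
  have hn (n : ℕ) : ‖g (r n)‖ ≤ √(f.quad b) * (9 / 10) ^ n := (hgn (r n)).trans (hq n)
  have hgeo : HasSum (fun n : ℕ ↦ √(f.quad b) * (9 / 10 : ℝ) ^ n) (10 * √(f.quad b)) := by
    have := (hasSum_geometric_of_lt_one (r := 9 / 10) (by norm_num) (by norm_num)).mul_left
      √(f.quad b)
    rwa [show ((1 : ℝ) - 9 / 10)⁻¹ = 10 by norm_num, mul_comm _ 10] at this
  have hsum : Summable fun n ↦ g (r n) := .of_norm_bounded hgeo.summable hn
  refine ⟨∑' n, g (r n), ?_, tsum_of_norm_bounded hgeo hn⟩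
  have hpartial (n : ℕ) : b - ∑ i ∈ Finset.range n, g (r i) = r n := by
    induction n with
    | zero => rw [Finset.sum_range_zero, sub_zero]; rfl
    | succ n ih => rw [Finset.sum_range_succ, hr, ← ih]; abel
  have hlim : Filter.Tendsto (fun n ↦ √(f.quad (r n))) Filter.atTop
      (nhds √(f.quad (b - ∑' n, g (r n)))) := by
    have := ((Real.continuous_sqrt.comp f.continuous_quad).tendsto _).comp
      (hsum.hasSum.tendsto_sum_nat.const_sub b)
    simpa only [Function.comp_def, hpartial] using this
  have hlim0 : Filter.Tendsto (fun n ↦ √(f.quad (r n))) Filter.atTop (nhds 0) :=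
    squeeze_zero (fun _ ↦ Real.sqrt_nonneg _) hq hgeo.summable.tendsto_atTop_zero
  exact (Real.sqrt_eq_zero (f.quad_nonneg _)).1 (tendsto_nhds_unique hlim hlim0)

/-- A pure state is determined by its left kernel. -/
theorem IsPureStateW.eq_of_quad_eq_zero [Nontrivial A] {ω ψ : WeakDual ℂ A}
    (hω : IsPureStateW ω) (hψ : IsStateW ψ)
    (h : ∀ a, hω.1.toPositive.quad a = 0 → hψ.toPositive.quad a = 0) : ψ = ω := by
  refine hω.eq_of_quad_le hψ (10 ^ 2) fun b ↦ ?_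
  obtain ⟨a, ha, han⟩ := hω.exists_quad_sub_eq_zero b
  have h1 : √(hψ.toPositive.quad b) ≤ 10 * √(hω.1.toPositive.quad b) := by
    calc √(hψ.toPositive.quad b) = √(hψ.toPositive.quad ((b - a) + a)) := by
          rw [sub_add_cancel]
      _ ≤ √(hψ.toPositive.quad (b - a)) + √(hψ.toPositive.quad a) :=
        hψ.toPositive.sqrt_quad_add_le _ _
      _ ≤ ‖a‖ := by
        rw [h _ ha, Real.sqrt_zero, zero_add]
        exact Real.sqrt_le_iff.2 ⟨norm_nonneg a, hψ.toPositive.quad_le hψ.toPositive_one a⟩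
      _ ≤ _ := han
  calc hψ.toPositive.quad b = √(hψ.toPositive.quad b) ^ 2 :=
        (Real.sq_sqrt (hψ.toPositive.quad_nonneg b)).symm
    _ ≤ (10 * √(hω.1.toPositive.quad b)) ^ 2 := by gcongr
    _ = _ := by rw [mul_pow, Real.sq_sqrt (hω.1.toPositive.quad_nonneg b)]

theorem IsPureStateW.exists_nonneg_apply_eq_zero [Nontrivial A] {ω : WeakDual ℂ A}
    (hω : IsPureStateW ω) {K : Set (WeakDual ℂ A)} (hK : K ⊆ stateSpace A)
    (hKcpt : IsCompact K) (hωK : ω ∉ K) :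
    ∃ a : A, 0 ≤ a ∧ ω a = 0 ∧ ∀ ψ ∈ K, 0 < (ψ a).re := by
  have hpt (ψ : WeakDual ℂ A) (hψ : ψ ∈ K) :
      ∃ b : A, ω (star b * b) = 0 ∧ 0 < (ψ (star b * b)).re := by
    by_contra! hcon
    refine hωK ((hω.eq_of_quad_eq_zero (hK hψ) fun b hb ↦ ?_) ▸ hψ)
    refine le_antisymm (hcon b ?_) (PositiveLinearMap.quad_nonneg _ b)
    rw [← hω.1.toPositive_apply, ← PositiveLinearMap.coe_quad, hb, Complex.ofReal_zero]
  obtain ⟨s, hs⟩ := hKcpt.elim_finite_subcover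
    (fun b : {b : A // ω (star b * b) = 0} ↦
      {ψ : WeakDual ℂ A | 0 < (ψ (star b.1 * b.1)).re})
    (fun b ↦ isOpen_lt continuous_const
      (Complex.continuous_re.comp (WeakDual.eval_continuous _)))
    fun ψ hψ ↦ by
      obtain ⟨b, hb, hb'⟩ := hpt ψ hψ
      exact Set.mem_iUnion.2 ⟨⟨b, hb⟩, hb'⟩
  refine ⟨∑ b ∈ s, star b.1 * b.1, Finset.sum_nonneg fun b _ ↦ star_mul_self_nonneg _, ?_,
    fun ψ hψ ↦ ?_⟩
  · rw [map_sum]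
    exact Finset.sum_eq_zero fun b _ ↦ b.2
  · rw [map_sum, Complex.re_sum]
    obtain ⟨b, hbs, hb⟩ := Set.mem_iUnion₂.1 (hs hψ)
    exact Finset.sum_pos' (fun b _ ↦ (IsStateW.toPositive (hK hψ)).quad_nonneg _) ⟨b, hbs, hb⟩

theorem IsPureStateW.exists_separating [Nontrivial A] {ω : WeakDual ℂ A}
    (hω : IsPureStateW ω) {K : Set (WeakDual ℂ A)} (hK : K ⊆ stateSpace A)
    (hKcpt : IsCompact K) (hωK : ω ∉ K) :
    ∃ γ : ℝ, 0 < γ ∧ γ < 1 ∧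
      ∃ f : A, 0 ≤ f ∧ f ≤ 1 ∧ ω f = 1 ∧ ∀ ψ ∈ K, ψ f < (γ : ℂ) := by
  obtain ⟨a, ha, hωa, hKa⟩ := hω.exists_nonneg_apply_eq_zero hK hKcpt hωK
  obtain ⟨δ, hδ, hKδ⟩ := hKcpt.exists_forall_le'
    (Complex.continuous_re.comp (WeakDual.eval_continuous a)).continuousOn hKa
  set M : ℝ := ‖a‖ + 1 with hM
  have hM0 : 0 < M := by positivity
  have hM1 : 1 ≤ M := by rw [hM]; linarith [norm_nonneg a]
  set η : ℝ := min δ 1 / (2 * M) with hη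
  have hη0 : 0 < η := by positivity
  have hη1 : η < 1 := by
    rw [hη, div_lt_one (by positivity)]
    linarith [min_le_right δ 1]
  have happly {φ : WeakDual ℂ A} (hφ : IsStateW φ) :
      φ (1 - M⁻¹ • a) = ((1 - M⁻¹ * (φ a).re : ℝ) : ℂ) := by
    have h : φ a = (φ a).re := Complex.eq_re_of_ofReal_le (hφ.apply_nonneg ha)
    rw [map_sub, hφ.1, ← Complex.coe_smul, map_smul, h]
    simp
  refine ⟨1 - η, by linarith, by linarith, 1 - M⁻¹ • a, ?_,
    sub_le_self _ (smul_nonneg (by positivity) ha), ?_, fun ψ hψ ↦ ?_⟩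
  · rw [sub_nonneg, ← CStarAlgebra.norm_le_one_iff_of_nonneg _ (smul_nonneg (by positivity) ha),
      norm_smul, Real.norm_of_nonneg (by positivity), inv_mul_le_one₀ hM0]
    linarith
  · rw [happly hω.1, hωa]
    simp
  · rw [happly (hK hψ)]
    have h : δ ≤ (ψ a).re := hKδ ψ hψ
    have h1 : η < M⁻¹ * (ψ a).re := by
      rw [hη, inv_mul_eq_div, div_lt_div_iff₀ (by positivity) hM0]
      nlinarith [min_le_left δ 1]
    exact_mod_cast (by linarith : 1 - M⁻¹ * (ψ a).re < 1 - η)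

end PositiveFunctionals

theorem stmt9 [PartialOrder B] [StarOrderedRing B]
    (ω : WeakDual ℂ B) (hω : IsPureStateW ω)
    (K : Set (WeakDual ℂ B)) (hK : K ⊆ stateSpace B) (hKcpt : IsCompact K) (hωK : ω ∉ K) :
    ∃ γ : ℝ, 0 < γ ∧ γ < 1 ∧
      ∃ f : B, 0 ≤ f ∧ f ≤ 1 ∧ ω f = 1 ∧ ∀ ψ ∈ K, ψ f < (γ : ℂ) := by
  have : Nontrivial B := by
    refine nontrivial_of_ne 1 0 fun h ↦ one_ne_zero (α := ℂ) ?_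
    rw [← hω.1.1, h, map_zero]
  let _ : CStarAlgebra B := {}
  exact IsPureStateW.exists_separating hω hK hKcpt hωK
end
end

section
/- Let B be a separable unital C*-algebra, let A ⊆ B be a unital norm-closed subalgebra, and let ω be a pure state on B. If ω admits an excision consisting of elements of A, i.e., there exist a directed set Λ and a family (e_λ)_{λ∈Λ} with e_λ ∈ A, ‖e_λ‖ ≤ 1 for all λ, lim_λ ω(e_λ) = 1, and lim_λ ‖e_λ* (b − ω(b)·1) e_λ‖ = 0 for every b ∈ B, then the restriction of ω to A has a unique extension to a state on B. -/
noncomputable section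

open scoped ComplexOrder

variable {B : Type*} [NormedRing B] [StarRing B] [CStarRing B] [NormedAlgebra ℂ B]
  [StarModule ℂ B] [CompleteSpace B]

namespace IsState

variable {φ : B →ₗ[ℂ] ℂ}

lemma im_apply_eq_zero (hφ : IsState φ) {a : B} (ha : IsSelfAdjoint a) : (φ a).im = 0 := by
  have key (t : ℝ) : 2 * (φ a).im * t ≤ ‖a‖ ^ 2 := by
    set x : B := a + ((t : ℂ) * Complex.I) • (1 : B) with hx
    have hxx : star x * x = a * a + ((t : ℂ) ^ 2) • (1 : B) := by
      simp only [hx, star_add, star_smul, star_one, ha.star_eq, star_mul', Complex.star_def,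
        Complex.conj_I, Complex.conj_ofReal, add_mul, mul_add, smul_mul_assoc, mul_smul_comm,
        one_mul, mul_one, smul_add, smul_smul]
      have h : (t : ℂ) * Complex.I * (t * -Complex.I) = (t : ℂ) ^ 2 := by
        linear_combination (-(t : ℂ) ^ 2) * Complex.I_sq
      rw [h, mul_neg, neg_smul]
      abel
    have hnx : ‖x‖ ^ 2 ≤ ‖a‖ ^ 2 + t ^ 2 := by
      have : Nontrivial B := ⟨1, 0, fun h => by simpa [h] using hφ.1⟩
      calc ‖x‖ ^ 2 = ‖star x * x‖ := by rw [CStarRing.norm_star_mul_self, sq]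
        _ ≤ ‖a * a‖ + ‖((t : ℂ) ^ 2) • (1 : B)‖ := hxx ▸ norm_add_le _ _
        _ ≤ ‖a‖ ^ 2 + t ^ 2 := by
          gcongr
          · exact (norm_mul_le _ _).trans_eq (sq _).symm
          · simp [norm_smul]
    have hφx : φ x = φ a + t * Complex.I := by simp [hx, hφ.1]
    have h := (pow_le_pow_left₀ (norm_nonneg _) (hφ.2 x) 2).trans hnx
    rw [Complex.sq_norm, Complex.normSq_apply, hφx] at h
    simp only [Complex.add_re, Complex.add_im, Complex.mul_re, Complex.mul_im, Complex.ofReal_re,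
      Complex.ofReal_im, Complex.I_re, Complex.I_im] at h
    nlinarith [sq_nonneg (φ a).re, sq_nonneg (φ a).im]
  by_contra h
  have := key ((‖a‖ ^ 2 + 1) / (2 * (φ a).im))
  rw [mul_div_cancel₀ _ (mul_ne_zero two_ne_zero h)] at this
  linarith

lemma apply_star_s11 (hφ : IsState φ) (x : B) : φ (star x) = star (φ x) := by
  have h₁ := hφ.im_apply_eq_zero (IsSelfAdjoint.add_star_self x)
  have h₂ := hφ.im_apply_eq_zero (a := Complex.I • (x - star x)) <| by
    simp [isSelfAdjoint_iff, ← smul_neg]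
  apply Complex.ext
  · simp at h₂ ⊢
    linarith
  · simp at h₁ ⊢
    linarith

lemma re_apply_star_mul_self_nonneg (hφ : IsState φ) (x : B) : 0 ≤ (φ (star x * x)).re := by
  let _ : CStarAlgebra B := CStarAlgebra.mk
  let _ : PartialOrder B := CStarAlgebra.spectralOrder B
  have : StarOrderedRing B := CStarAlgebra.spectralOrderedRing B
  have hunit (y : B) (hy : ‖y‖ ≤ 1) : 0 ≤ (φ (star y * y)).re := by
    have hle : star y * y ≤ 1 := by
      rw [← CStarAlgebra.norm_le_one_iff_of_nonneg _ (star_mul_self_nonneg y),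
        CStarRing.norm_star_mul_self]
      exact mul_le_one₀ hy (norm_nonneg _) hy
    have hnorm : ‖1 - star y * y‖ ≤ 1 := by
      rw [CStarAlgebra.norm_le_one_iff_of_nonneg _ (sub_nonneg.2 hle)]
      exact sub_le_self _ (star_mul_self_nonneg y)
    have h := (Complex.re_le_norm _).trans ((hφ.2 _).trans hnorm)
    rw [map_sub, hφ.1, Complex.sub_re, Complex.one_re] at h
    linarith
  rcases eq_or_ne x 0 with rfl | hx
  · simp
  have hx' : 0 < ‖x‖ := norm_pos_iff.2 hx
  have h := hunit (((‖x‖⁻¹ : ℝ) : ℂ) • x) (by simp [norm_smul, hx'.ne'])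
  rw [star_smul, smul_mul_smul_comm, map_smul, Complex.star_def, Complex.conj_ofReal,
    ← Complex.ofReal_mul, smul_eq_mul, Complex.re_ofReal_mul] at h
  exact nonneg_of_mul_nonneg_right h (by positivity)

/-- The pre-inner product `⟪x, y⟫ = φ (star x * y)` induced by a state `φ`. -/
@[reducible]
def preInnerProductSpaceCore (hφ : IsState φ) : PreInnerProductSpace.Core ℂ B where
  inner x y := φ (star x * y)
  conj_inner_symm x y := by
    rw [← Complex.star_def, ← hφ.apply_star_s11, star_mul, star_star]
  re_inner_nonneg := hφ.re_apply_star_mul_self_nonneg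
  add_left x y z := by rw [star_add, add_mul, map_add]
  smul_left x y r := by simp

/-- The Cauchy–Schwarz inequality for states. -/
lemma norm_apply_star_mul_sq_le (hφ : IsState φ) (x y : B) :
    ‖φ (star x * y)‖ ^ 2 ≤ (φ (star x * x)).re * (φ (star y * y)).re := by
  let _ := hφ.preInnerProductSpaceCore
  have h : ‖φ (star x * y)‖ * ‖φ (star y * x)‖ ≤ (φ (star x * x)).re * (φ (star y * y)).re :=
    InnerProductSpace.Core.inner_mul_inner_self_le (𝕜 := ℂ) x y
  have hsymm : ‖φ (star y * x)‖ = ‖φ (star x * y)‖ := by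
    rw [← norm_star (φ (star x * y)), ← hφ.apply_star_s11, star_mul, star_star]
  rwa [hsymm, ← sq] at h

lemma re_apply_star_mul_self_le (hφ : IsState φ) (x : B) : (φ (star x * x)).re ≤ ‖x‖ ^ 2 := by
  rw [sq, ← CStarRing.norm_star_mul_self]
  exact (Complex.re_le_norm _).trans (hφ.2 _)

lemma re_apply_star_one_sub_mul_one_sub_le (hφ : IsState φ) {e : B} (he : ‖e‖ ≤ 1) :
    (φ (star (1 - e) * (1 - e))).re ≤ 2 - 2 * (φ e).re := by
  have h := (hφ.re_apply_star_mul_self_le e).trans (pow_le_one₀ (norm_nonneg _) he)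
  have hexp : star (1 - e) * (1 - e) = 1 - e - star e + star e * e := by
    rw [star_sub, star_one]
    noncomm_ring
  rw [hexp, map_add, map_sub, map_sub, hφ.1, hφ.apply_star_s11]
  simp only [Complex.add_re, Complex.sub_re, Complex.one_re, Complex.star_def, Complex.conj_re]
  linarith

lemma norm_apply_star_one_sub_mul_le (hφ : IsState φ) {e : B} (he : ‖e‖ ≤ 1) (x : B) :
    ‖φ (star (1 - e) * x)‖ ≤ √(2 - 2 * (φ e).re) * ‖x‖ := by
  have h₁ := hφ.re_apply_star_one_sub_mul_one_sub_le he
  have h₀ := (hφ.re_apply_star_mul_self_nonneg (1 - e)).trans h₁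
  refine (sq_le_sq₀ (norm_nonneg _) (by positivity)).1 ?_
  rw [mul_pow, Real.sq_sqrt h₀]
  exact (hφ.norm_apply_star_mul_sq_le _ _).trans <|
    mul_le_mul h₁ (hφ.re_apply_star_mul_self_le x) (hφ.re_apply_star_mul_self_nonneg x) h₀

lemma norm_apply_le_of_compression (hφ : IsState φ) {e : B} (he : ‖e‖ ≤ 1) (x : B) :
    ‖φ x‖ ≤ 2 * √(2 - 2 * (φ e).re) * ‖x‖ + ‖star e * x * e‖ := by
  have hdecomp : x = star (1 - e) * x + star e * x * (1 - e) + star e * x * e := by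
    rw [star_sub, star_one]
    noncomm_ring
  have h₂ : ‖φ (star e * x * (1 - e))‖ ≤ √(2 - 2 * (φ e).re) * ‖x‖ := by
    rw [← norm_star, ← hφ.apply_star_s11, star_mul]
    refine (hφ.norm_apply_star_one_sub_mul_le he _).trans ?_
    gcongr
    rw [norm_star]
    refine (norm_mul_le _ _).trans ?_
    rw [norm_star]
    exact mul_le_of_le_one_left (norm_nonneg _) he
  calc ‖φ x‖ = ‖φ (star (1 - e) * x) + φ (star e * x * (1 - e)) + φ (star e * x * e)‖ := by
        rw [← map_add, ← map_add, ← hdecomp]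
    _ ≤ ‖φ (star (1 - e) * x)‖ + ‖φ (star e * x * (1 - e))‖ + ‖φ (star e * x * e)‖ :=
        norm_add₃_le
    _ ≤ √(2 - 2 * (φ e).re) * ‖x‖ + √(2 - 2 * (φ e).re) * ‖x‖ + ‖star e * x * e‖ :=
        add_le_add_three (hφ.norm_apply_star_one_sub_mul_le he x) h₂ (hφ.2 _)
    _ = 2 * √(2 - 2 * (φ e).re) * ‖x‖ + ‖star e * x * e‖ := by ring

end IsState

theorem stmt11 [TopologicalSpace.SeparableSpace B]
    (A : Subalgebra ℂ B) (hAclosed : IsClosed (A : Set B))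
    (ω : B →ₗ[ℂ] ℂ) (hω : IsPureState ω)
    (Λ : Type*) [Preorder Λ] [Nonempty Λ] [IsDirected Λ (· ≤ ·)]
    (e : Λ → B) (heA : ∀ l, e l ∈ A) (hcontr : ∀ l, ‖e l‖ ≤ 1)
    (hlim1 : Filter.Tendsto (fun l => ω (e l)) Filter.atTop (nhds 1))
    (hlim2 : ∀ b : B, Filter.Tendsto
      (fun l => ‖star (e l) * (b - ω b • (1 : B)) * e l‖) Filter.atTop (nhds 0)) :
    ∀ ψ : B →ₗ[ℂ] ℂ, IsState ψ → (∀ a ∈ A, ψ a = ω a) → ψ = ω := by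
  intro ψ hψ hψω
  ext b
  set c : B := b - ω b • (1 : B) with hc
  have hre : Filter.Tendsto (fun l => (ω (e l)).re) Filter.atTop (nhds 1) :=
    (Complex.continuous_re.tendsto 1).comp hlim1
  have hsqrt : Filter.Tendsto (fun l => √(2 - 2 * (ω (e l)).re)) Filter.atTop (nhds 0) := by
    simpa using ((hre.const_mul 2).const_sub 2).sqrt
  have hbound : Filter.Tendsto
      (fun l => 2 * √(2 - 2 * (ω (e l)).re) * ‖c‖ + ‖star (e l) * c * e l‖)
      Filter.atTop (nhds 0) := by
    simpa using ((hsqrt.const_mul 2).mul_const ‖c‖).add (hlim2 b)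
  have hψc : ‖ψ c‖ ≤ 0 := ge_of_tendsto' hbound fun l => by
    rw [← hψω _ (heA l)]
    exact hψ.norm_apply_le_of_compression (hcontr l) c
  have h := norm_le_zero_iff.1 hψc
  rwa [hc, map_sub, map_smul, hψ.1, smul_eq_mul, mul_one, sub_eq_zero] at h
end
end

section
/- Let B be a separable unital C*-algebra and let A ⊆ B be a unital norm-closed subalgebra. Let E ⊆ A be the set of elements x with ‖x‖ = 1 for which the set {ψ|_A : ψ a state on B with ψ(x*x) = 1} is a singleton (i.e., any two states ψ₁, ψ₂ on B with ψ₁(x*x) = ψ₂(x*x) = 1 agree on A). Then E is dense in the unit sphere {x ∈ A : ‖x‖ = 1} of A with respect to the norm topology. -/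
noncomputable section

open scoped ComplexOrder

variable {B : Type*} [NormedRing B] [StarRing B] [CStarRing B] [NormedAlgebra ℂ B]
  [StarModule ℂ B] [CompleteSpace B]

/-- On any line, arbitrarily close to a given point, there are points at which the symmetric second
difference of the norm is small compared with the step. -/
theorem exists_second_difference_lt {F : Type*} [NormedAddCommGroup F] [NormedSpace ℝ F]
    (x v : F) {ε η : ℝ} (hε : 0 < ε) (hη : 0 < η) :
    ∃ t : ℝ, |t| < ε ∧ ∃ δ : ℝ, 0 < δ ∧
      ‖x + t • v + δ • v‖ + ‖x + t • v - δ • v‖ - 2 * ‖x + t • v‖ < η * δ := by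
  set g : ℝ → ℝ := fun t => ‖x + t • v‖ with hg
  have hLip : LipschitzWith ‖v‖₊ g := by
    refine LipschitzWith.of_dist_le_mul fun s t => ?_
    rw [Real.dist_eq, Real.dist_eq]
    refine (abs_norm_sub_norm_le _ _).trans (le_of_eq ?_)
    rw [add_sub_add_left_eq_sub, ← sub_smul, norm_smul, Real.norm_eq_abs, mul_comm, coe_nnnorm]
  have hdense := MeasureTheory.Measure.dense_of_ae hLip.ae_differentiableAt_real
  obtain ⟨t, ht, hdiff⟩ := hdense.exists_mem_open (Metric.isOpen_ball (x := (0 : ℝ)) (ε := ε))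
    ⟨0, Metric.mem_ball_self hε⟩
  refine ⟨t, by simpa using hdiff, ?_⟩
  have hlo := (hasDerivAt_iff_isLittleO.mp (DifferentiableAt.hasDerivAt ht)).def
    (show (0 : ℝ) < η / 4 by positivity)
  obtain ⟨r, hr, H⟩ := Metric.eventually_nhds_iff.mp hlo
  refine ⟨r / 2, by positivity, ?_⟩
  have h1 := H (y := t + r / 2) (by rw [Real.dist_eq, add_sub_cancel_left, abs_of_pos] <;> linarith)
  have h2 := H (y := t - r / 2)
    (by rw [Real.dist_eq, sub_sub_cancel_left, abs_neg, abs_of_pos] <;> linarith)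
  rw [add_sub_cancel_left, Real.norm_eq_abs, Real.norm_eq_abs, abs_of_pos (half_pos hr),
    smul_eq_mul] at h1
  rw [sub_sub_cancel_left, norm_neg, Real.norm_eq_abs, Real.norm_eq_abs, abs_of_pos (half_pos hr),
    smul_eq_mul] at h2
  have e1 : ‖x + t • v + (r / 2) • v‖ = g (t + r / 2) := by rw [hg]; simp only [add_smul, add_assoc]
  have e2 : ‖x + t • v - (r / 2) • v‖ = g (t - r / 2) := by
    rw [hg]; simp only [sub_smul, add_sub_assoc]
  rw [e1, e2]
  change g (t + r / 2) + g (t - r / 2) - 2 * g t < _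
  have := (abs_le.mp h1).2
  have := (abs_le.mp h2).2
  have := mul_pos hη hr
  linarith

/-- Mazur's theorem for the norm of a separable Banach space: densely many points have a unique
norming functional. -/
theorem dense_setOf_unique_norming {F : Type*} [NormedAddCommGroup F] [NormedSpace ℝ F]
    [CompleteSpace F] [TopologicalSpace.SeparableSpace F] :
    Dense {x : F | ∀ f g : F →L[ℝ] ℝ, (∀ y, f y ≤ ‖y‖) → (∀ y, g y ≤ ‖y‖) →
      f x = ‖x‖ → g x = ‖x‖ → f = g} := by
  set v := TopologicalSpace.denseSeq F
  let U : ℕ × ℕ → Set F := fun p => {x | ∃ δ : ℝ, 0 < δ ∧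
    ‖x + δ • v p.1‖ + ‖x - δ • v p.1‖ - 2 * ‖x‖ < 1 / ((p.2 : ℝ) + 1) * δ}
  have hopen : ∀ p, IsOpen (U p) := by
    intro p
    have : U p = ⋃ δ : ℝ, ⋃ _ : 0 < δ, {x | ‖x + δ • v p.1‖ + ‖x - δ • v p.1‖ - 2 * ‖x‖ <
        1 / ((p.2 : ℝ) + 1) * δ} := by
      ext x; simp [U]
    rw [this]
    exact isOpen_iUnion fun δ => isOpen_iUnion fun _ =>
      isOpen_lt (by fun_prop) continuous_const
  have hdense : ∀ p, Dense (U p) := by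
    intro p
    rw [Metric.dense_iff]
    intro x r hr
    obtain ⟨t, ht, hδ⟩ := exists_second_difference_lt x (v p.1)
      (show 0 < r / (‖v p.1‖ + 1) by positivity)
      (show (0 : ℝ) < 1 / ((p.2 : ℝ) + 1) by positivity)
    refine ⟨x + t • v p.1, ?_, hδ⟩
    rw [Metric.mem_ball, dist_eq_norm, add_sub_cancel_left, norm_smul, Real.norm_eq_abs]
    rw [lt_div_iff₀ (by positivity)] at ht
    nlinarith [abs_nonneg t]
  refine (dense_iInter_of_isOpen hopen hdense).mono fun x hx f g hf hg hfx hgx => ?_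
  have key : ∀ n, f (v n) = g (v n) := by
    intro n
    have half : ∀ f g : F →L[ℝ] ℝ, (∀ y, f y ≤ ‖y‖) → (∀ y, g y ≤ ‖y‖) →
        f x = ‖x‖ → g x = ‖x‖ → f (v n) - g (v n) ≤ 0 := by
      intro f g hf hg hfx hgx
      refine le_of_forall_pos_le_add fun ε hε => ?_
      obtain ⟨m, hm⟩ := exists_nat_one_div_lt hε
      obtain ⟨δ, hδ, H⟩ := Set.mem_iInter.mp hx (n, m)
      have h1 := hf (x + δ • v n)
      have h2 := hg (x - δ • v n)
      simp only [map_add, map_sub, map_smul, smul_eq_mul] at h1 h2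
      have h3 : δ * (f (v n) - g (v n)) < δ * (1 / ((m : ℝ) + 1)) := by
        dsimp only at H; linarith
      have := lt_of_mul_lt_mul_left h3 hδ.le
      linarith
    exact le_antisymm (sub_nonpos.mp (half f g hf hg hfx hgx))
      (sub_nonpos.mp (half g f hg hf hgx hfx))
  have := (TopologicalSpace.denseRange_denseSeq F).equalizer f.continuous g.continuous (funext key)
  exact DFunLike.coe_injective this

/-- A contraction `z` satisfies a Pythagorean-type bound for the complementary pair `star z * z`,
`1 - star z * z`. -/
theorem norm_star_mul_self_add_sq_le {C : Type*} [CStarAlgebra C] [PartialOrder C]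
    [StarOrderedRing C] {z : C} (hz : ‖z‖ ≤ 1) (c : C) :
    ‖star z * z + (1 - star z * z) * c‖ ^ 2 ≤ 1 + 2 * ‖c‖ ^ 2 := by
  rcases subsingleton_or_nontrivial C with hC | hC
  · have : ‖star z * z + (1 - star z * z) * c‖ = 0 := by
      rw [norm_eq_zero]; exact Subsingleton.elim _ _
    rw [this, zero_pow two_ne_zero]; positivity
  set w := star z * z + (1 - star z * z) * c with hw
  have hzz : ‖star z * z‖ ≤ 1 := by
    rw [CStarRing.norm_star_mul_self]; nlinarith [norm_nonneg z]
  have hpos : 0 ≤ 1 - z * star z := by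
    rw [sub_nonneg, ← CStarAlgebra.norm_le_one_iff_of_nonneg _ (mul_star_self_nonneg z),
      CStarRing.norm_self_mul_star]
    nlinarith [norm_nonneg z]
  have hle : star w * w ≤ star z * z + star c * (1 - star z * z) * c := by
    rw [← sub_nonneg]
    have : star z * z + star c * (1 - star z * z) * c - star w * w =
        star (z * (1 - c)) * (1 - z * star z) * (z * (1 - c)) := by
      simp only [hw, star_add, star_sub, star_mul, star_one, star_star]
      noncomm_ring
    rw [this]
    exact star_left_conjugate_nonneg hpos _
  calc ‖w‖ ^ 2 = ‖star w * w‖ := by rw [CStarRing.norm_star_mul_self, sq]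
    _ ≤ ‖star z * z + star c * (1 - star z * z) * c‖ :=
      CStarAlgebra.norm_le_norm_of_nonneg_of_le (star_mul_self_nonneg w) hle
    _ ≤ ‖star z * z‖ + ‖star c‖ * ‖1 - star z * z‖ * ‖c‖ :=
      (norm_add_le _ _).trans (by gcongr; exact norm_mul₃_le)
    _ ≤ 1 + ‖c‖ * 2 * ‖c‖ := by
      have : ‖1 - star z * z‖ ≤ 2 := (norm_sub_le _ _).trans (by rw [norm_one]; linarith)
      rw [norm_star]; gcongr
    _ = _ := by ring

/-- `star z * z` lies in the multiplicative domain of every state taking the value `1` there. -/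
theorem IsState.map_star_mul_self_mul {ψ : B →ₗ[ℂ] ℂ} (hψ : IsState ψ) {z : B} (hz : ‖z‖ ≤ 1)
    (h : ψ (star z * z) = 1) (b : B) : ψ (star z * z * b) = ψ b := by
  let : CStarAlgebra B := { }
  let : PartialOrder B := CStarAlgebra.spectralOrder B
  have : StarOrderedRing B := CStarAlgebra.spectralOrderedRing B
  set u := ψ ((1 - star z * z) * b) with hu
  suffices hu0 : u = 0 by
    rw [hu, sub_mul, one_mul, map_sub, sub_eq_zero] at hu0
    exact hu0.symm
  set t : ℝ := 1 / (‖b‖ ^ 2 + 1) with ht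
  have htpos : 0 < t := by positivity
  have hval : ψ (star z * z + (1 - star z * z) * ((t * starRingEnd ℂ u : ℂ) • b)) =
      ((1 + t * ‖u‖ ^ 2 : ℝ) : ℂ) := by
    rw [map_add, h, mul_smul_comm, map_smul, ← hu, smul_eq_mul, mul_assoc, Complex.conj_mul']
    push_cast; rfl
  have h1 := hψ.2 (star z * z + (1 - star z * z) * ((t * starRingEnd ℂ u : ℂ) • b))
  rw [hval, Complex.norm_real, Real.norm_eq_abs, abs_of_nonneg (by positivity)] at h1
  have h2 := norm_star_mul_self_add_sq_le hz ((t * starRingEnd ℂ u : ℂ) • b)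
  have h3 := (pow_le_pow_left₀ (by positivity) h1 2).trans h2
  rw [norm_smul, norm_mul, RCLike.norm_conj, Complex.norm_real, Real.norm_eq_abs,
    abs_of_pos htpos] at h3
  have htb : t * ‖b‖ ^ 2 = 1 - t := by rw [ht]; field_simp; ring
  have h4 : (t * ‖u‖ * ‖b‖) ^ 2 = t * ‖u‖ ^ 2 * (1 - t) := by rw [← htb]; ring
  rw [h4] at h3
  have h5 : 0 < t ^ 2 := by positivity
  have h6 : ‖u‖ ^ 2 ≤ 0 := by
    by_contra! hlt
    nlinarith [mul_pos h5 hlt, sq_nonneg (t * ‖u‖ ^ 2)]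
  exact norm_eq_zero.mp (pow_eq_zero_iff two_ne_zero |>.mp (le_antisymm h6 (sq_nonneg _)))

/-- The real functional `a ↦ Re ψ (star z * a)` on a subalgebra. -/
def IsState.reFunctional {ψ : B →ₗ[ℂ] ℂ} (hψ : IsState ψ) (A : Subalgebra ℂ B) (z : B) :
    A →L[ℝ] ℝ :=
  Complex.reCLM.comp (((ψ.mkContinuous 1 fun b => by simpa using hψ.2 b).comp
    ((ContinuousLinearMap.mul ℂ B (star z)).comp A.toSubmodule.subtypeL)).restrictScalars ℝ)

set_option linter.unusedSectionVars false in
theorem IsState.reFunctional_apply {ψ : B →ₗ[ℂ] ℂ} (hψ : IsState ψ) (A : Subalgebra ℂ B) (z : B)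
    (a : A) : hψ.reFunctional A z a = (ψ (star z * a)).re :=
  rfl

set_option linter.unusedSectionVars false in
theorem IsState.reFunctional_le {ψ : B →ₗ[ℂ] ℂ} (hψ : IsState ψ) (A : Subalgebra ℂ B) {z : B}
    (hz : ‖z‖ ≤ 1) (a : A) : hψ.reFunctional A z a ≤ ‖a‖ := by
  rw [hψ.reFunctional_apply]
  calc (ψ (star z * a)).re ≤ ‖ψ (star z * a)‖ := Complex.re_le_norm _
    _ ≤ ‖star z * (a : B)‖ := hψ.2 _
    _ ≤ ‖star z‖ * ‖(a : B)‖ := norm_mul_le _ _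
    _ ≤ 1 * ‖(a : B)‖ := by rw [norm_star]; gcongr
    _ = ‖a‖ := one_mul _

/-- If `y` has a unique norming functional on `A`, then all states peaking at the normalization of
`y` agree on `A`. -/
theorem unique_restriction_normalize (A : Subalgebra ℂ B) {y : A} (hy0 : y ≠ 0)
    (hy : ∀ f g : A →L[ℝ] ℝ, (∀ a, f a ≤ ‖a‖) → (∀ a, g a ≤ ‖a‖) →
      f y = ‖y‖ → g y = ‖y‖ → f = g) :
    (((‖y‖⁻¹ : ℝ) : ℂ) • (y : B)) ∈ {x : B | x ∈ A ∧ ‖x‖ = 1 ∧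
      ∀ ψ₁ ψ₂ : B →ₗ[ℂ] ℂ, IsState ψ₁ → IsState ψ₂ →
        ψ₁ (star x * x) = 1 → ψ₂ (star x * x) = 1 →
        ∀ a ∈ A, ψ₁ a = ψ₂ a} := by
  have hpos : ‖y‖ ≠ 0 := norm_ne_zero_iff.mpr hy0
  set z : B := ((‖y‖⁻¹ : ℝ) : ℂ) • (y : B) with hz
  have hzA : z ∈ A := A.smul_mem y.2 _
  have hz1 : ‖z‖ = 1 := by
    rw [hz, norm_smul, Complex.norm_real, norm_inv, norm_norm]
    exact inv_mul_cancel₀ hpos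
  have hyz : (y : B) = ((‖y‖ : ℝ) : ℂ) • z := by
    rw [hz, smul_smul, ← Complex.ofReal_mul, mul_inv_cancel₀ hpos, Complex.ofReal_one, one_smul]
  refine ⟨hzA, hz1, fun ψ₁ ψ₂ hψ₁ hψ₂ h₁ h₂ b hb => ?_⟩
  have norming : ∀ {ψ : B →ₗ[ℂ] ℂ} (hψ : IsState ψ), ψ (star z * z) = 1 →
      hψ.reFunctional A z y = ‖y‖ := by
    intro ψ hψ h
    rw [hψ.reFunctional_apply, hyz, mul_smul_comm, map_smul, h, smul_eq_mul, mul_one,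
      Complex.ofReal_re]
  have heq := hy _ _ (hψ₁.reFunctional_le A hz1.le) (hψ₂.reFunctional_le A hz1.le)
    (norming hψ₁ h₁) (norming hψ₂ h₂)
  have hre : ∀ a ∈ A, (ψ₁ (star z * a)).re = (ψ₂ (star z * a)).re := fun a ha =>
    congrArg (fun f : A →L[ℝ] ℝ => f ⟨a, ha⟩) heq
  rw [← hψ₁.map_star_mul_self_mul hz1.le h₁ b, ← hψ₂.map_star_mul_self_mul hz1.le h₂ b, mul_assoc]
  have hzb : z * b ∈ A := A.mul_mem hzA hb
  refine Complex.ext (hre _ hzb) ?_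
  simpa [mul_smul_comm] using hre _ (A.smul_mem hzb Complex.I)

theorem stmt14 [TopologicalSpace.SeparableSpace B]
    (A : Subalgebra ℂ B) (hAclosed : IsClosed (A : Set B))
    (E : Set B)
    (hE : E = {x : B | x ∈ A ∧ ‖x‖ = 1 ∧
      ∀ ψ₁ ψ₂ : B →ₗ[ℂ] ℂ, IsState ψ₁ → IsState ψ₂ →
        ψ₁ (star x * x) = 1 → ψ₂ (star x * x) = 1 →
        ∀ a ∈ A, ψ₁ a = ψ₂ a}) :
    {x : B | x ∈ A ∧ ‖x‖ = 1} ⊆ closure E := by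
  rintro x ⟨hxA, hx⟩
  have : CompleteSpace A := hAclosed.completeSpace_coe
  have : SecondCountableTopology B := UniformSpace.secondCountable_of_separable B
  have : TopologicalSpace.SeparableSpace A :=
    inferInstanceAs (TopologicalSpace.SeparableSpace (A : Set B))
  have hcont : ContinuousAt (fun y : A => ((‖y‖⁻¹ : ℝ) : ℂ) • (y : B)) ⟨x, hxA⟩ := by
    have hne : ‖(⟨x, hxA⟩ : A)‖ ≠ 0 := by
      change ‖x‖ ≠ 0
      rw [hx]; exact one_ne_zero
    exact (Complex.continuous_ofReal.continuousAt.comp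
      (continuous_norm.continuousAt.inv₀ hne)).smul continuous_subtype_val.continuousAt
  have hval : ((‖(⟨x, hxA⟩ : A)‖⁻¹ : ℝ) : ℂ) • x = x := by
    change ((‖x‖⁻¹ : ℝ) : ℂ) • x = x
    rw [hx]; simp
  have hlim := hcont.tendsto
  simp only [hval] at hlim
  have hne : ∀ᶠ y : A in nhds ⟨x, hxA⟩, y ≠ 0 := by
    refine isOpen_ne.mem_nhds fun h => ?_
    have : x = 0 := congrArg Subtype.val h
    rw [this, norm_zero] at hx
    exact zero_ne_one hx
  refine mem_closure_of_frequently_of_tendsto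
    (((mem_closure_iff_frequently.mp
      (dense_setOf_unique_norming (F := A) ⟨x, hxA⟩)).and_eventually hne).mono ?_) hlim
  rintro y ⟨hy, hy0⟩
  rw [hE]
  exact unique_restriction_normalize A hy0 hy
end
end
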